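/- arXiv:1806.10806 — 7 statements merged into one kernel-verified Lean document; each statement's English description precedes it below -/
import Mathlib

section
/- Let A, B be commuting positive invertible bounded linear operators on a complex Hilbert space with ‖B^{-1/2} A B^{-1/2} − I‖ < 1, and let λ ∈ (0,1). Then A ∇_λ B − A ♯_λ B = Σ_{k=2}^∞ (−1)^{k−1} C(1−λ, k) · B^{(1−k)/2} (B−A)^k B^{(1−k)/2}, with convergence in operator norm. -/
open scoped NNReal

/-- The generalized binomial coefficient `C(α, k) = α(α−1)⋯(α−k+1)/k!`. -/
noncomputable def genBinom (α : ℝ) (k : ℕ) : ℝ :=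
  (∏ i ∈ Finset.range k, (α - i)) / (k.factorial : ℝ)

/-- The λ-weighted geometric mean `A ♯_λ B := A^{1/2} (A^{-1/2} B A^{-1/2})^λ A^{1/2}`,
with real powers given by the continuous functional calculus. -/
noncomputable def geomMeanWt {H : Type*} [NormedAddCommGroup H] [InnerProductSpace ℂ H]
    [CompleteSpace H] (lam : ℝ) (A B : H →L[ℂ] H) : H →L[ℂ] H :=
  A ^ ((1 : ℝ) / 2) * (A ^ (-(1 : ℝ) / 2) * B * A ^ (-(1 : ℝ) / 2)) ^ lam * A ^ ((1 : ℝ) / 2)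

theorem ringChoose_eq_genBinom (a : ℝ) (k : ℕ) : Ring.choose a k = genBinom a k := by
  rw [Ring.choose_eq_smul, ← Polynomial.aeval_eq_smeval, ← Polynomial.eval_map_algebraMap,
    descPochhammer_map, descPochhammer_eval_eq_prod_range, genBinom, smul_eq_mul, div_eq_inv_mul]

section CStarAlgebra

variable {𝔸 : Type*} [CStarAlgebra 𝔸] [PartialOrder 𝔸] [StarOrderedRing 𝔸]

/-- The binomial series of a strictly positive element at distance less than one from `1`. -/
theorem hasSum_genBinom_smul_sub_one_pow {c : 𝔸} (hc : IsStrictlyPositive c)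
    (hnorm : ‖c - 1‖ < 1) (a : ℝ) :
    HasSum (fun k : ℕ => genBinom a k • (c - 1) ^ k) (c ^ a) := by
  have hsa : IsSelfAdjoint c := hc.nonneg.isSelfAdjoint
  have hps : HasFPowerSeriesOnBall (fun x : ℝ => x ^ a) (binomialSeries ℝ a) 1 1 := by
    simpa using (Real.one_add_rpow_hasFPowerSeriesOnBall_zero (a := a)).comp_sub 1
  have hsub : cfc (fun x : ℝ => x - 1) c = c - 1 := by
    rw [cfc_sub (fun x : ℝ => x) (fun _ => 1) c, cfc_id' ℝ c, cfc_const_one ℝ c]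
  obtain ⟨r, hr, hr1⟩ := exists_between hnorm
  lift r to ℝ≥0 using (norm_nonneg _).trans hr.le
  have hspec : spectrum ℝ c ⊆ Metric.ball 1 r := fun x hx => by
    rw [mem_ball_iff_norm]
    refine lt_of_le_of_lt ?_ hr
    simpa only [hsub] using norm_apply_le_norm_cfc (fun x : ℝ => x - 1) c hx
  have htend : Filter.Tendsto (fun n => ∑ k ∈ Finset.range n, genBinom a k • (c - 1) ^ k)
      Filter.atTop (nhds (c ^ a)) := by
    rw [CFC.rpow_eq_cfc_real hc.nonneg]
    have h := tendsto_cfc_fun (a := c)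
      ((hps.tendstoUniformlyOn' (r' := r) (by exact_mod_cast hr1)).mono hspec)
      (.of_forall fun n => ((binomialSeries ℝ a).partialSum_continuous n).comp_continuousOn
        (by fun_prop))
    refine h.congr fun n => ?_
    have hpoly : (fun y : ℝ => (binomialSeries ℝ a).partialSum n (y - 1)) =
        ∑ k ∈ Finset.range n, fun y : ℝ => genBinom a k • (y - 1) ^ k := by
      ext y
      simp [FormalMultilinearSeries.partialSum, binomialSeries, ringChoose_eq_genBinom, mul_comm]
    rw [hpoly, cfc_sum _ _ _ fun k _ => by fun_prop]
    refine Finset.sum_congr rfl fun k _ => ?_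
    rw [cfc_smul (genBinom a k) (fun y : ℝ => (y - 1) ^ k) c,
      cfc_pow (fun y : ℝ => y - 1) k c, hsub]
  have hsum : Summable fun k : ℕ => genBinom a k • (c - 1) ^ k := by
    have hreal := (binomialSeries ℝ a).summable_norm_apply (x := ‖c - 1‖)
      (Metric.eball_subset_eball hps.r_le (by
        rwa [mem_eball_zero_iff, enorm_norm, ← ofReal_norm, ENNReal.ofReal_lt_one]))
    refine .of_norm_bounded_eventually_nat hreal ?_
    filter_upwards [Filter.eventually_gt_atTop 0] with k hk
    rw [norm_smul]
    simpa [binomialSeries, ringChoose_eq_genBinom, mul_comm] using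
      mul_le_mul_of_nonneg_left (norm_pow_le' (c - 1) hk) (norm_nonneg (genBinom a k))
  exact hsum.hasSum_iff_tendsto_nat.mpr htend

theorem Commute.rpow_right {a b : 𝔸} (h : Commute a b) (x : ℝ) : Commute a (b ^ x) :=
  (h.symm.cfc_nnreal _).symm

theorem rpow_mul_mul_rpow_of_commute {a b : 𝔸} (hb : IsUnit b) (h : Commute a b) (x y : ℝ) :
    b ^ x * a * b ^ y = a * b ^ (x + y) := by
  rw [← (h.rpow_right x).eq, mul_assoc, ← CFC.rpow_add hb]

theorem isStrictlyPositive_rpow_mul_mul_rpow {a b : 𝔸} (ha : IsStrictlyPositive a)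
    (hb : IsStrictlyPositive b) (x : ℝ) : IsStrictlyPositive (b ^ x * a * b ^ x) :=
  ((hb.isUnit.cfcRpow x hb.nonneg).mul ha.isUnit |>.mul
    (hb.isUnit.cfcRpow x hb.nonneg)).isStrictlyPositive
    (conjugate_nonneg_of_nonneg ha.nonneg CFC.rpow_nonneg)

end CStarAlgebra

theorem geomMeanWt_eq_of_commute {H : Type*} [NormedAddCommGroup H] [InnerProductSpace ℂ H]
    [CompleteSpace H] {A B : H →L[ℂ] H} (hA : IsStrictlyPositive A) (hB : IsStrictlyPositive B)
    (h : Commute A B) (lam : ℝ) :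
    geomMeanWt lam A B =
      (B ^ (-(1 : ℝ) / 2) * A * B ^ (-(1 : ℝ) / 2)) ^ (1 - lam) * B := by
  have hCpos := isStrictlyPositive_rpow_mul_mul_rpow hA hB (-(1 : ℝ) / 2)
  have hC := rpow_mul_mul_rpow_of_commute hB.isUnit h (-(1 : ℝ) / 2) (-(1 : ℝ) / 2)
  have hE := rpow_mul_mul_rpow_of_commute hA.isUnit h.symm (-(1 : ℝ) / 2) (-(1 : ℝ) / 2)
  rw [show -(1 : ℝ) / 2 + -(1 : ℝ) / 2 = -1 by norm_num] at hC hE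
  rw [geomMeanWt]
  set C := B ^ (-(1 : ℝ) / 2) * A * B ^ (-(1 : ℝ) / 2)
  set E := A ^ (-(1 : ℝ) / 2) * B * A ^ (-(1 : ℝ) / 2)
  have hAinv : A ^ (-1 : ℝ) * A = 1 := by
    simpa [CFC.rpow_one A hA.nonneg] using CFC.rpow_neg_mul_rpow (a := A) 1 hA
  have hBinv : B * B ^ (-1 : ℝ) = 1 := by
    simpa [CFC.rpow_one B hB.nonneg] using CFC.rpow_mul_rpow_neg (a := B) 1 hB
  have hBinv' : B ^ (-1 : ℝ) * B = 1 := by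
    simpa [CFC.rpow_one B hB.nonneg] using CFC.rpow_neg_mul_rpow (a := B) 1 hB
  have hCinv : C * C ^ (-1 : ℝ) = 1 := by
    simpa [CFC.rpow_one C hCpos.nonneg] using CFC.rpow_mul_rpow_neg (a := C) 1 hCpos
  have hEC : E = C ^ (-1 : ℝ) := by
    refine left_inv_eq_right_inv (a := C) ?_ hCinv
    rw [hE, hC, mul_assoc, ← mul_assoc _ A, hAinv, one_mul, hBinv]
  have hCB : C * B = A := by rw [hC, mul_assoc, hBinv', mul_one]
  have hAE : Commute A E := by
    rw [hE]
    exact h.mul_right ((Commute.refl A).rpow_right _)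
  rw [rpow_mul_mul_rpow_of_commute hA.isUnit (hAE.rpow_right lam).symm, add_halves,
    CFC.rpow_one A hA.nonneg, hEC, CFC.rpow_rpow C _ _ (by norm_num) hCpos,
    sub_eq_neg_add, CFC.rpow_add hCpos.isUnit, CFC.rpow_one C hCpos.nonneg, mul_assoc, hCB,
    neg_one_mul]

/-- **Series identity for commuting operators.**
If `A, B` are commuting positive invertible operators on a complex Hilbert space with
`‖B^{-1/2} A B^{-1/2} - I‖ < 1` and `λ ∈ (0,1)`, then
`A ∇_λ B − A ♯_λ B = Σ_{k=2}^∞ (−1)^{k−1} C(1−λ, k) • B^{(1−k)/2} (B−A)^k B^{(1−k)/2}`,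
the series converging in operator norm. -/
theorem alzer_series_identity_commute {H : Type*} [NormedAddCommGroup H] [InnerProductSpace ℂ H]
    [CompleteSpace H] (A B : H →L[ℂ] H) (hA : 0 ≤ A) (hB : 0 ≤ B)
    (hAu : IsUnit A) (hBu : IsUnit B) (hcomm : Commute A B)
    (hnorm : ‖B ^ (-(1 : ℝ) / 2) * A * B ^ (-(1 : ℝ) / 2) - 1‖ < 1)
    (lam : ℝ) (hlam0 : 0 < lam) (hlam1 : lam < 1) :
    HasSum
      (fun k : ℕ =>
        ((-1 : ℝ) ^ (k + 1) * genBinom (1 - lam) (k + 2)) •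
          (B ^ ((1 - ((k : ℝ) + 2)) / 2) * (B - A) ^ (k + 2) *
            B ^ ((1 - ((k : ℝ) + 2)) / 2)))
      (((1 - lam) • A + lam • B) - geomMeanWt lam A B) := by
  have hApos : IsStrictlyPositive A := hAu.isStrictlyPositive hA
  have hBpos : IsStrictlyPositive B := hBu.isStrictlyPositive hB
  have hCpos := isStrictlyPositive_rpow_mul_mul_rpow hApos hBpos (-(1 : ℝ) / 2)
  have hC := rpow_mul_mul_rpow_of_commute hBu hcomm (-(1 : ℝ) / 2) (-(1 : ℝ) / 2)
  rw [show -(1 : ℝ) / 2 + -(1 : ℝ) / 2 = -1 by norm_num] at hC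
  rw [geomMeanWt_eq_of_commute hApos hBpos hcomm]
  set C := B ^ (-(1 : ℝ) / 2) * A * B ^ (-(1 : ℝ) / 2)
  have hBinv : B ^ (-1 : ℝ) * B = 1 := by
    simpa [CFC.rpow_one B hB] using CFC.rpow_neg_mul_rpow (a := B) 1 hBpos
  have hCB : C * B = A := by rw [hC, mul_assoc, hBinv, mul_one]
  have hcommC : Commute C B := by
    rw [hC]
    exact hcomm.mul_left ((Commute.refl B).rpow_right _).symm
  have hpow (n : ℕ) : (B - A) ^ n * B ^ (1 - (n : ℝ)) = (-1 : ℝ) ^ n • ((C - 1) ^ n * B) := by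
    have hdiff : B - A = (-1 : ℝ) • ((C - 1) * B) := by
      rw [sub_mul, hCB, one_mul, neg_one_smul, neg_sub]
    rw [hdiff, smul_pow, (hcommC.sub_left (Commute.one_left B)).mul_pow, smul_mul_assoc, mul_assoc,
      ← CFC.rpow_natCast B n hB, ← CFC.rpow_add hBu, add_sub_cancel, CFC.rpow_one B hB]
  have hsum := ((hasSum_nat_add_iff' 2).mpr
    (hasSum_genBinom_smul_sub_one_pow hCpos hnorm (1 - lam))).mul_right B |>.neg
  convert! hsum using 1
  · ext1 k
    have hexp : (1 - ((k : ℝ) + 2)) / 2 + (1 - ((k : ℝ) + 2)) / 2 = 1 - ((k + 2 : ℕ) : ℝ) := by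
      push_cast
      ring
    have hcommBA : Commute ((B - A) ^ (k + 2)) B :=
      ((Commute.refl B).sub_left hcomm).pow_left _
    rw [rpow_mul_mul_rpow_of_commute hBu hcommBA, hexp, hpow, smul_smul, smul_mul_assoc, ← neg_smul]
    congr 1
    have hsq : ((-1 : ℝ) ^ k) * (-1) ^ k = 1 := by rw [← mul_pow]; norm_num
    linear_combination (-genBinom (1 - lam) (k + 2)) * hsq
  · have h0 : genBinom (1 - lam) 0 = 1 := by simp [genBinom]
    have h1 : genBinom (1 - lam) 1 = 1 - lam := by simp [genBinom]
    rw [Finset.sum_range_succ, Finset.sum_range_one, h0, h1, pow_zero, pow_one, one_smul,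
      sub_mul, add_mul, one_mul, smul_mul_assoc, sub_mul, hCB, one_mul]
    module
end

section
/- (Alzer inequality for operators) Let A, B be commuting selfadjoint bounded linear operators on a complex Hilbert space with 0 < A ≤ B ≤ (1/2)I, set A' := I − A and B' := I − B, and let 0 < λ ≤ 1/2. Then B' ∇_λ A' − B' ♯_λ A' ≤ A ∇_λ B − A ♯_λ B in the operator order. -/
open scoped NNReal

open scoped ComplexOrder in
/-- A real power of a positive operator given as a real-valued function of a normal operator `T`. -/
theorem cfc_ofReal_rpow {H : Type*} [NormedAddCommGroup H] [InnerProductSpace ℂ H]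
    [CompleteSpace H] (T : H →L[ℂ] H) [IsStarNormal T] {f : ℂ → ℝ}
    (hf : ContinuousOn f (spectrum ℂ T)) (hpos : ∀ z ∈ spectrum ℂ T, 0 < f z) (s : ℝ) :
    cfc (fun z ↦ (f z : ℂ)) T ^ s = cfc (fun z ↦ ((f z ^ s : ℝ) : ℂ)) T := by
  have hfc : ContinuousOn (fun z ↦ (f z : ℂ)) (spectrum ℂ T) :=
    Complex.continuous_ofReal.comp_continuousOn hf
  have hnn : 0 ≤ cfc (fun z ↦ (f z : ℂ)) T :=
    cfc_nonneg fun z hz ↦ Complex.zero_le_real.mpr (hpos z hz).le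
  have hg : ContinuousOn (fun w : ℂ ↦ ((w.re ^ s : ℝ) : ℂ))
      ((fun z ↦ (f z : ℂ)) '' spectrum ℂ T) := by
    refine Complex.continuous_ofReal.comp_continuousOn
      (Complex.continuous_re.continuousOn.rpow_const ?_)
    rintro _ ⟨z, hz, rfl⟩
    exact Or.inl (by simpa using (hpos z hz).ne')
  rw [CFC.rpow_eq_cfc_real hnn, cfc_real_eq_complex _ hnn.isSelfAdjoint,
    ← cfc_comp' _ _ T hg hfc]
  simp

/-- Commuting weighted geometric mean, as a function of a normal operator `T`. -/
theorem geomMeanWt_cfc_ofReal {H : Type*} [NormedAddCommGroup H] [InnerProductSpace ℂ H]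
    [CompleteSpace H] (T : H →L[ℂ] H) [IsStarNormal T] {f g : ℂ → ℝ}
    (hf : ContinuousOn f (spectrum ℂ T)) (hg : ContinuousOn g (spectrum ℂ T))
    (hf0 : ∀ z ∈ spectrum ℂ T, 0 < f z) (hg0 : ∀ z ∈ spectrum ℂ T, 0 < g z) (lam : ℝ) :
    geomMeanWt lam (cfc (fun z ↦ (f z : ℂ)) T) (cfc (fun z ↦ (g z : ℂ)) T) =
      cfc (fun z ↦ ((f z ^ (1 - lam) * g z ^ lam : ℝ) : ℂ)) T := by
  have hpow (s : ℝ) : ContinuousOn (fun z ↦ f z ^ s) (spectrum ℂ T) :=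
    hf.rpow_const fun z hz ↦ Or.inl (hf0 z hz).ne'
  have lift {k : ℂ → ℝ} (hk : ContinuousOn k (spectrum ℂ T)) :
      ContinuousOn (fun z ↦ (k z : ℂ)) (spectrum ℂ T) :=
    Complex.continuous_ofReal.comp_continuousOn hk
  have hmul {k l : ℂ → ℝ} (hk : ContinuousOn k (spectrum ℂ T))
      (hl : ContinuousOn l (spectrum ℂ T)) :
      cfc (fun z ↦ (k z : ℂ)) T * cfc (fun z ↦ (l z : ℂ)) T =
        cfc (fun z ↦ ((k z * l z : ℝ) : ℂ)) T := by
    rw [← cfc_mul _ _ T (lift hk) (lift hl)]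
    simp
  have hpos (z : ℂ) (hz : z ∈ spectrum ℂ T) :
      0 < f z ^ (-(1 : ℝ) / 2) * g z * f z ^ (-(1 : ℝ) / 2) := by
    have := hf0 z hz
    have := hg0 z hz
    positivity
  have hleft : ContinuousOn (fun z ↦ f z ^ (-(1 : ℝ) / 2) * g z) (spectrum ℂ T) :=
    (hpow _).mul hg
  have hmid : ContinuousOn (fun z ↦ f z ^ (-(1 : ℝ) / 2) * g z * f z ^ (-(1 : ℝ) / 2))
      (spectrum ℂ T) := hleft.mul (hpow _)
  have hmidpow := hmid.rpow_const (p := lam) fun z hz ↦ Or.inl (hpos z hz).ne'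
  have hprod : ContinuousOn (fun z ↦ f z ^ ((1 : ℝ) / 2) *
      (f z ^ (-(1 : ℝ) / 2) * g z * f z ^ (-(1 : ℝ) / 2)) ^ lam) (spectrum ℂ T) :=
    (hpow _).mul hmidpow
  rw [geomMeanWt, cfc_ofReal_rpow T hf hf0, cfc_ofReal_rpow T hf hf0, hmul (hpow _) hg,
    hmul hleft (hpow _), cfc_ofReal_rpow T hmid hpos, hmul (hpow _) hmidpow,
    hmul hprod (hpow _)]
  refine cfc_congr fun z hz ↦ ?_
  have hfz := hf0 z hz
  have hgz := hg0 z hz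
  have hexp : f z ^ ((1 : ℝ) / 2) * (f z ^ (-(1 : ℝ) / 2 * lam) * g z ^ lam *
      f z ^ (-(1 : ℝ) / 2 * lam)) * f z ^ ((1 : ℝ) / 2) = f z ^ (1 - lam) * g z ^ lam := by
    rw [show 1 - lam = 1 / 2 + -1 / 2 * lam + -1 / 2 * lam + 1 / 2 by ring,
      Real.rpow_add hfz, Real.rpow_add hfz, Real.rpow_add hfz]
    ring
  rw [Real.mul_rpow (by positivity) (by positivity), Real.mul_rpow (by positivity) (by positivity),
    ← Real.rpow_mul hfz.le, hexp]

/-- The weighted geometric mean of positive reals is superadditive. -/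
theorem Real.rpow_mul_rpow_add_le {p q r s lam : ℝ} (hp : 0 < p) (hq : 0 < q) (hr : 0 ≤ r)
    (hs : 0 ≤ s) (h0 : 0 ≤ lam) (h1 : lam ≤ 1) :
    p ^ (1 - lam) * q ^ lam + r ^ (1 - lam) * s ^ lam ≤
      (p + r) ^ (1 - lam) * (q + s) ^ lam := by
  have hP : 0 < p + r := by positivity
  have hQ : 0 < q + s := by positivity
  have key {x y : ℝ} (hx : 0 ≤ x) (hy : 0 ≤ y) :
      x ^ (1 - lam) * y ^ lam / ((p + r) ^ (1 - lam) * (q + s) ^ lam) ≤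
        (1 - lam) * (x / (p + r)) + lam * (y / (q + s)) := by
    have := Real.geom_mean_le_arith_mean2_weighted (sub_nonneg.mpr h1) h0
      (div_nonneg hx hP.le) (div_nonneg hy hQ.le) (by ring)
    rwa [Real.div_rpow hx hP.le, Real.div_rpow hy hQ.le, div_mul_div_comm] at this
  have hsum : (1 - lam) * (p / (p + r)) + lam * (q / (q + s)) +
      ((1 - lam) * (r / (p + r)) + lam * (s / (q + s))) = 1 := by
    field_simp
    ring
  rw [← div_le_one (by positivity), add_div]
  linarith [key hp.le hq.le, key hr hs]

/-- The scalar Alzer inequality. -/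
theorem alzer_inequality_real {a b lam : ℝ} (ha : 0 < a) (hb : 0 < b) (hab : a + b ≤ 1)
    (h0 : 0 ≤ lam) (h1 : lam ≤ 1) :
    (1 - lam) * (1 - b) + lam * (1 - a) - (1 - b) ^ (1 - lam) * (1 - a) ^ lam ≤
      (1 - lam) * a + lam * b - a ^ (1 - lam) * b ^ lam := by
  have hc : 0 ≤ 1 - a - b := by linarith
  have h := Real.rpow_mul_rpow_add_le ha hb hc hc h0 h1
  rw [← Real.rpow_add_of_nonneg hc (sub_nonneg.mpr h1) h0, sub_add_cancel, Real.rpow_one,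
    show a + (1 - a - b) = 1 - b by ring, show b + (1 - a - b) = 1 - a by ring] at h
  linarith

open scoped ComplexOrder in
/-- **Alzer inequality for Hilbert space operators.**
If `A, B` are commuting selfadjoint operators with `0 < A ≤ B ≤ (1/2)I`
(`0 < A` meaning positive and invertible), `A' = I - A`, `B' = I - B` and `0 < λ ≤ 1/2`, then
`B' ∇_λ A' − B' ♯_λ A' ≤ A ∇_λ B − A ♯_λ B` in the Loewner order. -/
theorem alzer_inequality_operators {H : Type*} [NormedAddCommGroup H] [InnerProductSpace ℂ H]
    [CompleteSpace H] (A B : H →L[ℂ] H)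
    (hAsa : IsSelfAdjoint A) (hBsa : IsSelfAdjoint B) (hcomm : Commute A B)
    (hA : 0 ≤ A) (hAu : IsUnit A) (hAB : A ≤ B) (hB : B ≤ ((1 : ℝ) / 2) • (1 : H →L[ℂ] H))
    (lam : ℝ) (hlam0 : 0 < lam) (hlam1 : lam ≤ 1 / 2) :
    ((1 - lam) • (1 - B) + lam • (1 - A)) - geomMeanWt lam (1 - B) (1 - A) ≤
      ((1 - lam) • A + lam • B) - geomMeanWt lam A B := by
  set T : H →L[ℂ] H := A + Complex.I • B with hT
  have hstar : star T = A - Complex.I • B := by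
    simp [hT, hAsa.star_eq, hBsa.star_eq, sub_eq_add_neg]
  have hnormal : IsStarNormal T := ⟨by
    rw [hstar, hT]
    have hIB : Commute A (Complex.I • B) := hcomm.smul_right _
    exact ((Commute.refl A).sub_left hIB.symm).add_right
      (hIB.sub_left (Commute.refl (Complex.I • B)))⟩
  have lift {k : ℂ → ℝ} (hk : Continuous k) :
      ContinuousOn (fun z ↦ (k z : ℂ)) (spectrum ℂ T) :=
    (Complex.continuous_ofReal.comp hk).continuousOn
  have hTid : cfc (fun z : ℂ ↦ z) T = T := cfc_id' ℂ T
  have hTstar : cfc (fun z : ℂ ↦ star z) T = star T := cfc_star_id T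
  have hAT : A = cfc (fun z : ℂ ↦ (z.re : ℂ)) T := by
    have h : (fun z : ℂ ↦ (z.re : ℂ)) = fun z ↦ (1 / 2 : ℂ) • (z + star z) := by
      ext z
      simp [Complex.add_conj]
    rw [h, cfc_smul _ _ T, cfc_add T _ _, hTid, hTstar, hstar, hT]
    module
  have hBT : B = cfc (fun z : ℂ ↦ (z.im : ℂ)) T := by
    have h : (fun z : ℂ ↦ (z.im : ℂ)) = fun z ↦ (-Complex.I / 2 : ℂ) • (z - star z) := by
      ext z
      simp only [Complex.star_def, Complex.sub_conj, smul_eq_mul, Complex.ofReal_mul,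
        Complex.ofReal_ofNat]
      linear_combination (z.im : ℂ) * Complex.I_sq
    rw [h, cfc_smul _ _ T, cfc_sub _ _ T, hTid, hTstar, hstar, hT]
    have h2 : A + Complex.I • B - (A - Complex.I • B) = (2 * Complex.I) • B := by module
    rw [h2, smul_smul]
    have h3 : -Complex.I / 2 * (2 * Complex.I) = 1 := by
      linear_combination -Complex.I_sq
    rw [h3, one_smul]
  have hcre := Complex.continuous_re
  have hcim := Complex.continuous_im
  have hsub {k : ℂ → ℝ} (hk : Continuous k) :
      1 - cfc (fun z ↦ (k z : ℂ)) T = cfc (fun z ↦ ((1 - k z : ℝ) : ℂ)) T := by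
    rw [← cfc_const_one ℂ T, ← cfc_sub _ _ T continuousOn_const (lift hk)]
    simp
  have hle {z : ℂ} (hz : z ∈ spectrum ℂ T) : z.re ≤ z.im := by
    rw [hAT, hBT, cfc_le_iff _ _ T (lift hcre) (lift hcim)] at hAB
    exact Complex.real_le_real.mp (hAB z hz)
  have hhalf {z : ℂ} (hz : z ∈ spectrum ℂ T) : z.im ≤ 1 / 2 := by
    have h : ((1 : ℝ) / 2) • (1 : H →L[ℂ] H) = cfc (fun _ : ℂ ↦ (((1 : ℝ) / 2 : ℝ) : ℂ)) T := by
      rw [cfc_const _ T, Algebra.algebraMap_eq_smul_one, Complex.coe_smul]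
    rw [h, hBT, cfc_le_iff _ _ T (lift hcim) continuousOn_const] at hB
    exact Complex.real_le_real.mp (hB z hz)
  have hpos {z : ℂ} (hz : z ∈ spectrum ℂ T) : 0 < z.re := by
    rw [hAT, cfc_nonneg_iff _ T (lift hcre)] at hA
    rw [hAT, isUnit_cfc_iff _ T (lift hcre)] at hAu
    exact lt_of_le_of_ne (Complex.zero_le_real.mp (hA z hz))
      fun h ↦ hAu z hz (by simp [← h])
  have hcomb {k l m : ℂ → ℝ} (hk : Continuous k) (hl : Continuous l)
      (hm : ContinuousOn m (spectrum ℂ T)) :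
      ((1 - lam) • cfc (fun z ↦ (k z : ℂ)) T + lam • cfc (fun z ↦ (l z : ℂ)) T) -
        cfc (fun z ↦ (m z : ℂ)) T =
          cfc (fun z ↦ (((1 - lam) * k z + lam * l z - m z : ℝ) : ℂ)) T := by
    have hk' : ContinuousOn (fun z ↦ (1 - lam) • (k z : ℂ)) (spectrum ℂ T) :=
      (lift hk).fun_const_smul _
    have hl' : ContinuousOn (fun z ↦ lam • (l z : ℂ)) (spectrum ℂ T) := (lift hl).fun_const_smul _
    have hkl : ContinuousOn (fun z ↦ (1 - lam) • (k z : ℂ) + lam • (l z : ℂ)) (spectrum ℂ T) :=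
      hk'.add hl'
    rw [← cfc_smul _ _ T (lift hk), ← cfc_smul _ _ T (lift hl), ← cfc_add T _ _ hk' hl',
      ← cfc_sub _ (fun z ↦ (m z : ℂ)) T hkl (Complex.continuous_ofReal.comp_continuousOn hm)]
    simp
  have hmean {k l : ℂ → ℝ} (hk : Continuous k) (hl : Continuous l)
      (hk0 : ∀ z ∈ spectrum ℂ T, 0 < k z) (hl0 : ∀ z ∈ spectrum ℂ T, 0 < l z) :
      ContinuousOn (fun z ↦ k z ^ (1 - lam) * l z ^ lam) (spectrum ℂ T) :=
    (hk.continuousOn.rpow_const fun z hz ↦ Or.inl (hk0 z hz).ne').mul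
      (hl.continuousOn.rpow_const fun z hz ↦ Or.inl (hl0 z hz).ne')
  have him0 : ∀ z ∈ spectrum ℂ T, 0 < z.im := fun z hz ↦ (hpos hz).trans_le (hle hz)
  have hre1 : ∀ z ∈ spectrum ℂ T, 0 < 1 - z.re := fun z hz ↦ by linarith [hle hz, hhalf hz]
  have him1 : ∀ z ∈ spectrum ℂ T, 0 < 1 - z.im := fun z hz ↦ by linarith [hhalf hz]
  have hcre1 : Continuous fun z : ℂ ↦ 1 - z.re := continuous_const.sub hcre
  have hcim1 : Continuous fun z : ℂ ↦ 1 - z.im := continuous_const.sub hcim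
  have hm := hmean hcre hcim (fun _ ↦ hpos) him0
  have hm1 := hmean hcim1 hcre1 him1 hre1
  clear_value T
  subst hAT hBT
  rw [hsub hcre, hsub hcim,
    geomMeanWt_cfc_ofReal T hcre.continuousOn hcim.continuousOn (fun _ ↦ hpos) him0,
    geomMeanWt_cfc_ofReal T hcim1.continuousOn hcre1.continuousOn him1 hre1,
    hcomb hcre hcim hm, hcomb hcim1 hcre1 hm1]
  refine cfc_mono (fun z hz ↦ Complex.real_le_real.mpr ?_)
    (Complex.continuous_ofReal.comp_continuousOn
      (((continuous_const.mul hcim1).add (continuous_const.mul hcre1)).continuousOn.sub hm1))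
    (Complex.continuous_ofReal.comp_continuousOn
      (((continuous_const.mul hcre).add (continuous_const.mul hcim)).continuousOn.sub hm))
  exact alzer_inequality_real (hpos hz) (him0 z hz) (by linarith [hle hz, hhalf hz])
    hlam0.le (by linarith)
end

section
/- Let A, B be commuting selfadjoint bounded linear operators on a complex Hilbert space with 0 < A ≤ B ≤ (1/2)I, and set A' := I − A, B' := I − B. Then A' ∇ B' − A' ♯ B' ≤ A ∇ B − A ♯ B, where ∇ and ♯ denote the unweighted (λ = 1/2) arithmetic and geometric operator means. -/
open scoped NNReal

section CStarAlgebra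

variable {𝒜 : Type*} [CStarAlgebra 𝒜] [PartialOrder 𝒜] [StarOrderedRing 𝒜]

lemma Commute.cfc_sqrt {a b : 𝒜} (h : Commute a b) : Commute (CFC.sqrt a) b := by
  rw [CFC.sqrt_eq_cfc]
  exact h.cfc_nnreal _

lemma Commute.cfc_rpow {a b : 𝒜} (h : Commute a b) (x : ℝ) : Commute (a ^ x) b :=
  h.cfc_nnreal _

/-- A strictly positive factor commuting with `x` can be cancelled from `0 ≤ c * x`. -/
lemma IsStrictlyPositive.nonneg_of_mul_nonneg {c x : 𝒜} (hc : IsStrictlyPositive c)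
    (h : Commute c x) (hcx : 0 ≤ c * x) : 0 ≤ x := by
  have hinv : c ^ (-1 : ℝ) * c = 1 := by
    simpa only [CFC.rpow_one c hc.nonneg] using CFC.rpow_neg_mul_rpow 1 hc
  have hcomm : Commute (c ^ (-1 : ℝ)) (c * x) := ((Commute.refl c).mul_right h).cfc_rpow _
  simpa only [← mul_assoc, hinv, one_mul] using hcomm.mul_nonneg CFC.rpow_nonneg hcx

/-- For commuting operators the weighted product `a^{1/2} (a^{-1/2} b a^{-1/2})^{1/2} a^{1/2}`
is `a^{1/2} b^{1/2}`. -/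
lemma Commute.rpow_conj_rpow_half {a b : 𝒜} (h : Commute a b) (ha : IsStrictlyPositive a)
    (hb : 0 ≤ b) :
    a ^ ((1 : ℝ) / 2) * (a ^ (-(1 : ℝ) / 2) * b * a ^ (-(1 : ℝ) / 2)) ^ ((1 : ℝ) / 2) *
      a ^ ((1 : ℝ) / 2) = CFC.sqrt a * CFC.sqrt b := by
  set w := a ^ (-(1 : ℝ) / 2) with hw
  have hwq : Commute w (CFC.sqrt b) := (h.symm.cfc_sqrt).symm.cfc_rpow _
  have hpq : Commute (CFC.sqrt a) (CFC.sqrt b) := (h.symm.cfc_sqrt).symm.cfc_sqrt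
  have hroot : (w * b * w) ^ ((1 : ℝ) / 2) = w * CFC.sqrt b := by
    rw [← CFC.sqrt_eq_rpow]
    refine CFC.sqrt_unique ?_ (hwq.mul_nonneg CFC.rpow_nonneg (CFC.sqrt_nonneg b))
    calc w * CFC.sqrt b * (w * CFC.sqrt b) = w * CFC.sqrt b * (CFC.sqrt b * w) := by rw [hwq.eq]
      _ = w * (CFC.sqrt b * CFC.sqrt b) * w := by simp only [mul_assoc]
      _ = w * b * w := by rw [CFC.sqrt_mul_sqrt_self b hb]
  have hinv : CFC.sqrt a * w = 1 := by
    rw [hw, CFC.sqrt_eq_rpow, neg_div]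
    exact CFC.rpow_mul_rpow_neg _ ha
  rw [hroot, ← CFC.sqrt_eq_rpow, ← mul_assoc, hinv, one_mul, hpq.eq]

/-- If `p ≤ q` and `s ≤ r` are commuting, with `q² - p² = r² - s²` and `p + q ≤ r + s`, then
`(r - s)² ≤ (q - p)²`. -/
lemma sub_mul_self_le_sub_mul_self {p q r s : 𝒜} (hpq : Commute p q) (hpr : Commute p r)
    (hps : Commute p s) (hqr : Commute q r) (hqs : Commute q s) (hrs : Commute r s)
    (hpos : IsStrictlyPositive (p + q)) (hle : p ≤ q) (hsr : s ≤ r) (hsum : p + q ≤ r + s)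
    (heq : q * q - p * p = r * r - s * s) :
    (r - s) * (r - s) ≤ (q - p) * (q - p) := by
  have hD : 0 ≤ r - s := sub_nonneg.2 hsr
  have hE : 0 ≤ q - p := sub_nonneg.2 hle
  have hpD : Commute p (r - s) := hpr.sub_right hps
  have hqD : Commute q (r - s) := hqr.sub_right hqs
  have hrD : Commute r (r - s) := (Commute.refl r).sub_right hrs
  have hsD : Commute s (r - s) := hrs.symm.sub_right (Commute.refl s)
  have hED : Commute (q - p) (r - s) := hqD.sub_left hpD
  have hpE : Commute p (q - p) := hpq.sub_right (Commute.refl p)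
  have hqE : Commute q (q - p) := (Commute.refl q).sub_right hpq.symm
  have hkey : (p + q) * ((q - p) - (r - s)) = (r + s - (p + q)) * (r - s) := by
    rw [mul_sub, sub_mul, ← hrs.mul_self_sub_mul_self_eq, ← heq,
      hpq.symm.mul_self_sub_mul_self_eq, add_comm q p]
  have hdiff : 0 ≤ (q - p) - (r - s) := by
    refine hpos.nonneg_of_mul_nonneg ((hpE.sub_right hpD).add_left (hqE.sub_right hqD)) ?_
    rw [hkey]
    exact ((hrD.add_left hsD).sub_left (hpD.add_left hqD)).mul_nonneg (sub_nonneg.2 hsum) hD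
  rw [← sub_nonneg, hED.mul_self_sub_mul_self_eq]
  refine Commute.mul_nonneg (add_nonneg hE hD) hdiff ?_
  exact ((Commute.refl _).sub_right hED).add_left (hED.symm.sub_right (Commute.refl _))

/-- Twice the arithmetic-geometric gap of commuting positive elements is a square. -/
lemma Commute.half_smul_add_sub_sqrt_mul_sqrt {a b : 𝒜} (h : Commute a b) (ha : 0 ≤ a)
    (hb : 0 ≤ b) :
    ((1 : ℝ) / 2) • (a + b) - CFC.sqrt a * CFC.sqrt b =
      ((1 : ℝ) / 2) • ((CFC.sqrt b - CFC.sqrt a) * (CFC.sqrt b - CFC.sqrt a)) := by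
  have hpq : Commute (CFC.sqrt a) (CFC.sqrt b) := (h.symm.cfc_sqrt).symm.cfc_sqrt
  rw [sub_mul, mul_sub, mul_sub, CFC.sqrt_mul_sqrt_self a ha, CFC.sqrt_mul_sqrt_self b hb, hpq.eq]
  module

end CStarAlgebra

/-- **Unweighted Alzer inequality for Hilbert space operators.**
If `A, B` are commuting selfadjoint operators with `0 < A ≤ B ≤ (1/2)I`,
`A' = I - A`, `B' = I - B`, then `A' ∇ B' − A' ♯ B' ≤ A ∇ B − A ♯ B`. -/
theorem alzer_inequality_unweighted {H : Type*} [NormedAddCommGroup H] [InnerProductSpace ℂ H]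
    [CompleteSpace H] (A B : H →L[ℂ] H)
    (hAsa : IsSelfAdjoint A) (hBsa : IsSelfAdjoint B) (hcomm : Commute A B)
    (hA : 0 ≤ A) (hAu : IsUnit A) (hAB : A ≤ B) (hB : B ≤ ((1 : ℝ) / 2) • (1 : H →L[ℂ] H)) :
    ((1 : ℝ) / 2) • ((1 - A) + (1 - B)) - geomMeanWt ((1 : ℝ) / 2) (1 - A) (1 - B) ≤
      ((1 : ℝ) / 2) • (A + B) - geomMeanWt ((1 : ℝ) / 2) A B := by
  have hhalf : ((1 : ℝ) / 2) • (1 : H →L[ℂ] H) + ((1 : ℝ) / 2) • (1 : H →L[ℂ] H) = 1 := by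
    module
  have hBB' : B ≤ 1 - B := le_sub_iff_add_le.2 ((add_le_add hB hB).trans_eq hhalf)
  have hB'A' : 1 - B ≤ 1 - A := sub_le_sub_left hAB 1
  have hApos : IsStrictlyPositive A := hAu.isStrictlyPositive hA
  have hB0 : 0 ≤ B := hA.trans hAB
  have hB'0 : 0 ≤ 1 - B := hB0.trans hBB'
  have hA'pos : IsStrictlyPositive (1 - A) := hApos.of_le (hAB.trans (hBB'.trans hB'A'))
  have hA'B : Commute (1 - A) B := (Commute.one_left B).sub_left hcomm
  have hAA' : Commute A (1 - A) := (Commute.one_right A).sub_right (Commute.refl A)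
  have hAB' : Commute A (1 - B) := (Commute.one_right A).sub_right hcomm
  have hBB'c : Commute B (1 - B) := (Commute.one_right B).sub_right (Commute.refl B)
  have hA'B' : Commute (1 - A) (1 - B) := (Commute.one_left _).sub_left hAB'
  have hsqrt {X Y : H →L[ℂ] H} (h : Commute X Y) : Commute (CFC.sqrt X) (CFC.sqrt Y) :=
    h.symm.cfc_sqrt.symm.cfc_sqrt
  rw [geomMeanWt, geomMeanWt, hcomm.rpow_conj_rpow_half hApos hB0,
    hA'B'.rpow_conj_rpow_half hA'pos hB'0, hcomm.half_smul_add_sub_sqrt_mul_sqrt hA hB0,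
    hA'B'.half_smul_add_sub_sqrt_mul_sqrt hA'pos.nonneg hB'0,
    ← neg_mul_neg, neg_sub]
  refine smul_le_smul_of_nonneg_left ?_ (by norm_num)
  refine sub_mul_self_le_sub_mul_self (hsqrt hcomm) (hsqrt hAA') (hsqrt hAB')
    (hsqrt hA'B.symm) (hsqrt hBB'c) (hsqrt hA'B')
    ((hApos.sqrt).add_nonneg (CFC.sqrt_nonneg B)) (CFC.monotone_sqrt hAB)
    (CFC.monotone_sqrt hB'A') ?_ ?_
  · exact add_le_add (CFC.monotone_sqrt (hAB.trans (hBB'.trans hB'A'))) (CFC.monotone_sqrt hBB')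
  · rw [CFC.sqrt_mul_sqrt_self A hA, CFC.sqrt_mul_sqrt_self B hB0,
      CFC.sqrt_mul_sqrt_self (1 - A) hA'pos.nonneg, CFC.sqrt_mul_sqrt_self (1 - B) hB'0]
    abel
end

section
/- Let A, B be commuting selfadjoint bounded linear operators on a complex Hilbert space with 0 < A ≤ B ≤ (1/2)I, set A' := I − A and B' := I − B. Then for every integer k ≥ 2, A'^{(1−k)/2} (A' − B')^k A'^{(1−k)/2} ≤ B^{(1−k)/2} (B − A)^k B^{(1−k)/2} in the operator order. -/
open scoped NNReal

section CStarAlgebra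

variable {𝒜 : Type*} [CStarAlgebra 𝒜] [PartialOrder 𝒜] [StarOrderedRing 𝒜]

/-- Natural powers are monotone on commuting nonnegative elements of a C⋆-algebra. -/
lemma Commute.pow_le_pow_left_of_nonneg {a b : 𝒜} (h : Commute a b) (ha : 0 ≤ a) (hab : a ≤ b)
    (n : ℕ) : a ^ n ≤ b ^ n := by
  have hb : 0 ≤ b := ha.trans hab
  rw [← sub_nonneg, ← h.symm.geom_sum₂_mul n]
  refine Commute.mul_nonneg (Finset.sum_nonneg fun i _ ↦ ?_) (sub_nonneg.2 hab) ?_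
  · exact (h.symm.pow_pow _ _).mul_nonneg (CStarAlgebra.pow_nonneg hb _)
      (CStarAlgebra.pow_nonneg ha _)
  · refine Commute.sum_left _ _ _ fun i _ ↦ Commute.mul_left ?_ ?_
    · exact ((Commute.refl b).sub_right h.symm).pow_left _
    · exact (h.sub_right (Commute.refl a)).pow_left _

/-- The half-power `a ^ ((1 - k) / 2)` squares to the inverse of `a ^ (k - 1)`. -/
lemma CFC.rpow_half_mul_self_mul_pow {a : 𝒜} (ha : IsStrictlyPositive a) (n : ℕ) :
    a ^ ((1 - ((n + 1 : ℕ) : ℝ)) / 2) * a ^ ((1 - ((n + 1 : ℕ) : ℝ)) / 2) * a ^ n = 1 := by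
  rw [← CFC.rpow_add ha.isUnit, ← CFC.rpow_natCast a n ha.nonneg, ← CFC.rpow_add ha.isUnit]
  have h : (1 - ((n + 1 : ℕ) : ℝ)) / 2 + (1 - ((n + 1 : ℕ) : ℝ)) / 2 + (n : ℝ) = 0 := by
    push_cast
    ring
  rw [h, CFC.rpow_zero a ha.nonneg]

/-- If `0 < b ≤ a` and `0 ≤ d` commute pairwise, then the conjugate of `d ^ k` by
`a ^ ((1 - k) / 2)` is at most its conjugate by `b ^ ((1 - k) / 2)`. -/
lemma CFC.rpow_conj_pow_le_of_commute {a b d : 𝒜} (hb : IsStrictlyPositive b) (hba : b ≤ a)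
    (hd : 0 ≤ d) (hab : Commute a b) (had : Commute a d) (hbd : Commute b d) {k : ℕ}
    (hk : 1 ≤ k) :
    a ^ ((1 - (k : ℝ)) / 2) * d ^ k * a ^ ((1 - (k : ℝ)) / 2) ≤
      b ^ ((1 - (k : ℝ)) / 2) * d ^ k * b ^ ((1 - (k : ℝ)) / 2) := by
  obtain ⟨n, rfl⟩ := Nat.exists_eq_add_of_le' hk
  have ha : IsStrictlyPositive a := hb.of_le hba
  have hp1 := CFC.rpow_half_mul_self_mul_pow ha n
  have hq1 := CFC.rpow_half_mul_self_mul_pow hb n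
  set r : ℝ := (1 - ((n + 1 : ℕ) : ℝ)) / 2
  have rpow_comm {x y : 𝒜} (h : Commute x y) : Commute (x ^ r) y := h.cfc_nnreal _
  have hPd : Commute (a ^ r) (d ^ (n + 1)) := (rpow_comm had).pow_right _
  have hQd : Commute (b ^ r) (d ^ (n + 1)) := (rpow_comm hbd).pow_right _
  have hPa : Commute (a ^ r) a := rpow_comm (.refl a)
  have hPb : Commute (a ^ r) b := rpow_comm hab
  have hQa : Commute (b ^ r) a := rpow_comm hab.symm
  have hQb : Commute (b ^ r) b := rpow_comm (.refl b)
  have hPQ : Commute (a ^ r) (b ^ r) := rpow_comm (rpow_comm hab.symm).symm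
  have hP : 0 ≤ a ^ r * a ^ r :=
    (Commute.refl (a ^ r)).mul_nonneg CFC.rpow_nonneg CFC.rpow_nonneg
  have hQ : 0 ≤ b ^ r * b ^ r :=
    (Commute.refl (b ^ r)).mul_nonneg CFC.rpow_nonneg CFC.rpow_nonneg
  rw [hPd.eq, hQd.eq, mul_assoc, mul_assoc]
  generalize a ^ r = P at *
  generalize b ^ r = Q at *
  have hqp : Commute (Q * Q) (P * P) :=
    (hPQ.symm.mul_right hPQ.symm).mul_left (hPQ.symm.mul_right hPQ.symm)
  have hdiff : Q * Q - P * P = Q * Q * (P * P) * (a ^ n - b ^ n) := by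
    rw [mul_sub, mul_assoc _ _ (a ^ n), hp1, hqp.eq, mul_assoc _ _ (b ^ n), hq1, mul_one, mul_one]
  have hqp_comm : Commute (Q * Q * (P * P)) (a ^ n - b ^ n) :=
    ((hQa.mul_left hQa).mul_left (hPa.mul_left hPa)).pow_right n |>.sub_right
      (((hQb.mul_left hQb).mul_left (hPb.mul_left hPb)).pow_right n)
  have hle : 0 ≤ Q * Q - P * P := by
    rw [hdiff]
    exact hqp_comm.mul_nonneg (hqp.mul_nonneg hQ hP)
      (sub_nonneg.2 (hab.symm.pow_le_pow_left_of_nonneg hb.nonneg hba n))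
  rw [← sub_nonneg, ← mul_sub]
  exact ((hQd.mul_left hQd).sub_left (hPd.mul_left hPd)).symm.mul_nonneg
    (CStarAlgebra.pow_nonneg hd _) hle

end CStarAlgebra

/-- **Termwise inequality in the Alzer series.**
If `A, B` are commuting selfadjoint operators with `0 < A ≤ B ≤ (1/2)I`, `A' = I - A`,
`B' = I - B`, then for every `k ≥ 2`,
`A'^{(1−k)/2} (A' − B')^k A'^{(1−k)/2} ≤ B^{(1−k)/2} (B − A)^k B^{(1−k)/2}`,
where real powers are given by the continuous functional calculus. -/
theorem alzer_termwise_inequality {H : Type*} [NormedAddCommGroup H] [InnerProductSpace ℂ H]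
    [CompleteSpace H] (A B : H →L[ℂ] H)
    (hAsa : IsSelfAdjoint A) (hBsa : IsSelfAdjoint B) (hcomm : Commute A B)
    (hA : 0 ≤ A) (hAu : IsUnit A) (hAB : A ≤ B) (hB : B ≤ ((1 : ℝ) / 2) • (1 : H →L[ℂ] H))
    (k : ℕ) (hk : 2 ≤ k) :
    (1 - A) ^ ((1 - (k : ℝ)) / 2) * ((1 - A) - (1 - B)) ^ k * (1 - A) ^ ((1 - (k : ℝ)) / 2) ≤
      B ^ ((1 - (k : ℝ)) / 2) * (B - A) ^ k * B ^ ((1 - (k : ℝ)) / 2) := by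
  have hle : B ≤ 1 - A := by
    have h : A + B ≤ ((1 : ℝ) / 2) • (1 : H →L[ℂ] H) + ((1 : ℝ) / 2) • (1 : H →L[ℂ] H) :=
      add_le_add (hAB.trans hB) hB
    rw [← add_smul, add_halves, one_smul] at h
    rwa [le_sub_iff_add_le']
  have hBpos : IsStrictlyPositive B := IsStrictlyPositive.of_le (hAu.isStrictlyPositive hA) hAB
  rw [sub_sub_sub_cancel_left]
  exact CFC.rpow_conj_pow_le_of_commute hBpos hle (sub_nonneg.2 hAB)
    ((Commute.one_left B).sub_left hcomm)
    ((Commute.one_left _).sub_left (hcomm.sub_right (.refl A)))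
    ((Commute.refl B).sub_right hcomm.symm) (one_le_two.trans hk)
end

section
/- (Scalar Alzer inequality) Let n ≥ 1, let x_1, …, x_n ∈ (0, 1/2], and let λ_1, …, λ_n > 0 with Σ_{j=1}^n λ_j = 1. Set A_n = Σ_{j=1}^n λ_j x_j, G_n = Π_{j=1}^n x_j^{λ_j}, A'_n = Σ_{j=1}^n λ_j (1 − x_j), and G'_n = Π_{j=1}^n (1 − x_j)^{λ_j}. Then A'_n − G'_n ≤ A_n − G_n. -/
/-- The function `t ↦ (1 - g) log (1 - t) - g log t + 2 t` on `(0, 1/2]` is minimal at `g`. -/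
lemma min_log_combination {g x : ℝ} (hg : g ∈ Set.Ioc (0 : ℝ) (1 / 2))
    (hx : x ∈ Set.Ioc (0 : ℝ) (1 / 2)) :
    (1 - g) * Real.log (1 - g) - g * Real.log g + 2 * g ≤
      (1 - g) * Real.log (1 - x) - g * Real.log x + 2 * x := by
  set f : ℝ → ℝ := fun t ↦ (1 - g) * Real.log (1 - t) - g * Real.log t + 2 * t with hf
  change f g ≤ f x
  have hderiv : ∀ t ∈ Set.Ioc (0 : ℝ) (1 / 2),
      HasDerivAt f ((1 - 2 * t) * (t - g) / (t * (1 - t))) t := by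
    rintro t ⟨h0, h1⟩
    have ht : 1 - t ≠ 0 := by linarith
    have h := ((((hasDerivAt_id t).const_sub 1).log ht).const_mul (1 - g)).sub
      ((Real.hasDerivAt_log h0.ne').const_mul g) |>.add ((hasDerivAt_id t).const_mul 2)
    refine h.congr_deriv ?_
    simp only [id]
    field_simp
    ring
  rcases le_total x g with hxg | hgx
  · have hsub : Set.Icc x g ⊆ Set.Ioc (0 : ℝ) (1 / 2) :=
      fun t ht ↦ ⟨hx.1.trans_le ht.1, ht.2.trans hg.2⟩
    refine antitoneOn_of_deriv_nonpos (convex_Icc x g)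
      (fun t ht ↦ (hderiv t (hsub ht)).continuousAt.continuousWithinAt)
      (fun t ht ↦ (hderiv t (hsub (interior_subset ht))).differentiableAt.differentiableWithinAt)
      (fun t ht ↦ ?_) (Set.left_mem_Icc.2 hxg) (Set.right_mem_Icc.2 hxg) hxg
    have ht' := interior_subset ht
    obtain ⟨h0, h1⟩ := hsub ht'
    rw [(hderiv t ⟨h0, h1⟩).deriv]
    exact div_nonpos_of_nonpos_of_nonneg
      (mul_nonpos_of_nonneg_of_nonpos (by linarith) (by linarith [ht'.2]))
      (mul_nonneg h0.le (by linarith))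
  · have hsub : Set.Icc g x ⊆ Set.Ioc (0 : ℝ) (1 / 2) :=
      fun t ht ↦ ⟨hg.1.trans_le ht.1, ht.2.trans hx.2⟩
    refine monotoneOn_of_deriv_nonneg (convex_Icc g x)
      (fun t ht ↦ (hderiv t (hsub ht)).continuousAt.continuousWithinAt)
      (fun t ht ↦ (hderiv t (hsub (interior_subset ht))).differentiableAt.differentiableWithinAt)
      (fun t ht ↦ ?_) (Set.left_mem_Icc.2 hgx) (Set.right_mem_Icc.2 hgx) hgx
    have ht' := interior_subset ht
    obtain ⟨h0, h1⟩ := hsub ht'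
    rw [(hderiv t ⟨h0, h1⟩).deriv]
    exact div_nonneg (mul_nonneg (by linarith) (by linarith [ht'.1]))
      (mul_nonneg h0.le (by linarith))

lemma log_prod_rpow {ι : Type*} (s : Finset ι) {x w : ι → ℝ} (hx : ∀ i ∈ s, 0 < x i) :
    Real.log (∏ i ∈ s, x i ^ w i) = ∑ i ∈ s, w i * Real.log (x i) := by
  rw [Real.log_prod fun i hi ↦ (Real.rpow_pos_of_pos (hx i hi) _).ne']
  exact Finset.sum_congr rfl fun i hi ↦ Real.log_rpow (hx i hi) _

/-- **Scalar Alzer inequality.** For `x_1, …, x_n ∈ (0, 1/2]` and positive weights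
`λ_1, …, λ_n` summing to `1`, the weighted arithmetic and geometric means satisfy
`A'_n − G'_n ≤ A_n − G_n`, where the primed means are those of `1 − x_1, …, 1 − x_n`. -/
theorem scalar_alzer_inequality (n : ℕ) (hn : 1 ≤ n) (x lam : Fin n → ℝ)
    (hx : ∀ j, x j ∈ Set.Ioc (0 : ℝ) (1 / 2)) (hlam : ∀ j, 0 < lam j)
    (hsum : ∑ j, lam j = 1) :
    (∑ j, lam j * (1 - x j)) - (∏ j, (1 - x j) ^ lam j) ≤
      (∑ j, lam j * x j) - (∏ j, x j ^ lam j) := by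
  have hx' : ∀ j, 0 < 1 - x j := fun j ↦ by linarith [(hx j).2]
  have hlogG := log_prod_rpow Finset.univ (w := lam) fun j _ ↦ (hx j).1
  have hlogG' := log_prod_rpow Finset.univ (w := lam) fun j _ ↦ hx' j
  have hG : 0 < ∏ j, x j ^ lam j :=
    Finset.prod_pos fun j _ ↦ Real.rpow_pos_of_pos (hx j).1 _
  have hG' : 0 < ∏ j, (1 - x j) ^ lam j :=
    Finset.prod_pos fun j _ ↦ Real.rpow_pos_of_pos (hx' j) _
  set G := ∏ j, x j ^ lam j
  set G' := ∏ j, (1 - x j) ^ lam j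
  have hG_le : G ≤ 1 / 2 := by
    rw [← Real.log_le_log_iff hG (by norm_num), hlogG]
    calc ∑ j, lam j * Real.log (x j) ≤ ∑ j, lam j * Real.log (1 / 2) :=
          Finset.sum_le_sum fun j _ ↦
            mul_le_mul_of_nonneg_left (Real.log_le_log (hx j).1 (hx j).2) (hlam j).le
      _ = Real.log (1 / 2) := by rw [← Finset.sum_mul, hsum, one_mul]
  have hmean : (1 - G) * Real.log (1 - G) - G * Real.log G + 2 * G ≤
      (1 - G) * Real.log G' - G * Real.log G + 2 * ∑ j, lam j * x j := by
    calc (1 - G) * Real.log (1 - G) - G * Real.log G + 2 * G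
        = ∑ j, lam j * ((1 - G) * Real.log (1 - G) - G * Real.log G + 2 * G) := by
          rw [← Finset.sum_mul, hsum, one_mul]
      _ ≤ ∑ j, lam j * ((1 - G) * Real.log (1 - x j) - G * Real.log (x j) + 2 * x j) :=
          Finset.sum_le_sum fun j _ ↦
            mul_le_mul_of_nonneg_left (min_log_combination ⟨hG, hG_le⟩ (hx j)) (hlam j).le
      _ = (1 - G) * Real.log G' - G * Real.log G + 2 * ∑ j, lam j * x j := by
          rw [hlogG, hlogG', Finset.mul_sum, Finset.mul_sum, Finset.mul_sum,
            ← Finset.sum_sub_distrib, ← Finset.sum_add_distrib]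
          exact Finset.sum_congr rfl fun j _ ↦ by ring
  have hpos : 0 < 1 - G := by linarith
  have htangent : (1 - G) * (Real.log G' - Real.log (1 - G)) ≤ G' - (1 - G) := by
    rw [← Real.log_div hG'.ne' hpos.ne']
    calc (1 - G) * Real.log (G' / (1 - G)) ≤ (1 - G) * (G' / (1 - G) - 1) :=
          mul_le_mul_of_nonneg_left (Real.log_le_sub_one_of_pos (div_pos hG' hpos)) hpos.le
      _ = G' - (1 - G) := by field_simp
  have hA' : ∑ j, lam j * (1 - x j) = 1 - ∑ j, lam j * x j := by
    simp only [mul_sub, mul_one, Finset.sum_sub_distrib, hsum]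
  linarith
end

section
/- Let H be a complex Hilbert space, let m ≥ 2 be an integer, and let A, B be positive invertible bounded linear operators on H. Define the sequence {T_n} by T_0 = (1/m)A + ((m−1)/m)B and T_{n+1} = ((m−1)/m) T_n + (1/m) A (T_n^{-1} B)^{m−1}. Then T_n converges (decreasingly, in the operator order) to Φ_{1/m}(A, B) := B^{1/2} (B^{-1/2} A B^{-1/2})^{1/m} B^{1/2}. -/
open scoped NNReal

/-- The power operator mean `Φ_{1/m}(A, B) := B^{1/2} (B^{-1/2} A B^{-1/2})^{1/m} B^{1/2}`
(more generally `Φ_λ`), with real powers given by the continuous functional calculus. -/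
noncomputable def powerMean {H : Type*} [NormedAddCommGroup H] [InnerProductSpace ℂ H]
    [CompleteSpace H] (lam : ℝ) (A B : H →L[ℂ] H) : H →L[ℂ] H :=
  B ^ ((1 : ℝ) / 2) * (B ^ (-(1 : ℝ) / 2) * A * B ^ (-(1 : ℝ) / 2)) ^ lam * B ^ ((1 : ℝ) / 2)

open Filter Topology

/-- The Newton iteration for the equation `t ^ m = x`, started from `t = 1`. -/
noncomputable def newtonRoot (m : ℕ) : ℕ → ℝ → ℝ
  | 0, x => (m : ℝ)⁻¹ * x + ((m : ℝ) - 1) / m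
  | n + 1, x => ((m : ℝ) - 1) / m * newtonRoot m n x +
      (m : ℝ)⁻¹ * (x * ((newtonRoot m n x)⁻¹) ^ (m - 1))

lemma le_newton_step {m : ℕ} (hm : 2 ≤ m) {r t : ℝ} (hr : 0 ≤ r) (ht : 0 < t) :
    r ≤ ((m : ℝ) - 1) / m * t + (m : ℝ)⁻¹ * (r ^ m * (t⁻¹) ^ (m - 1)) := by
  obtain ⟨k, rfl⟩ : ∃ k, m = k + 1 := ⟨m - 1, by omega⟩
  have h := one_add_mul_le_pow (a := r / t - 1) (by have := div_nonneg hr ht.le; linarith) (k + 1)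
  rw [add_sub_cancel, div_pow] at h
  have h2 := mul_le_mul_of_nonneg_right h ht.le
  have h3 : r ^ (k + 1) / t ^ (k + 1) * t = r ^ (k + 1) * (t⁻¹) ^ k := by
    rw [inv_pow]; field_simp; ring
  have h4 : (1 + ((k + 1 : ℕ) : ℝ) * (r / t - 1)) * t = t + (k + 1) * (r - t) := by
    push_cast; field_simp
  rw [h3, h4] at h2
  have hk : (0 : ℝ) < k + 1 := by positivity
  simp only [Nat.add_sub_cancel]
  push_cast
  have h5 : ((k : ℝ) + 1 - 1) / (k + 1) * t + ((k : ℝ) + 1)⁻¹ * (r ^ (k + 1) * (t⁻¹) ^ k) =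
      (k * t + r ^ (k + 1) * (t⁻¹) ^ k) / (k + 1) := by
    field_simp; ring
  rw [h5, le_div_iff₀ hk]
  linarith

lemma newton_correction_le {m : ℕ} (hm : 2 ≤ m) {r t : ℝ} (hr : 0 < r) (hrt : r ≤ t) :
    r ^ m * (t⁻¹) ^ (m - 1) ≤ r := by
  obtain ⟨k, rfl⟩ : ∃ k, m = k + 1 := ⟨m - 1, by omega⟩
  have ht := hr.trans_le hrt
  rw [Nat.add_sub_cancel, inv_pow, ← div_eq_mul_inv, div_le_iff₀ (by positivity), pow_succ,
    mul_comm]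
  gcongr

lemma rpow_inv_natCast_pow_self {m : ℕ} (hm : 2 ≤ m) {x : ℝ} (hx : 0 < x) :
    (x ^ ((m : ℝ)⁻¹)) ^ m = x :=
  Real.rpow_inv_natCast_pow hx.le (by omega)

lemma rpow_inv_le_newtonRoot {m : ℕ} (hm : 2 ≤ m) {x : ℝ} (hx : 0 < x) (n : ℕ) :
    x ^ ((m : ℝ)⁻¹) ≤ newtonRoot m n x := by
  have hr : 0 < x ^ ((m : ℝ)⁻¹) := Real.rpow_pos_of_pos hx _
  have hrm := rpow_inv_natCast_pow_self hm hx
  induction n with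
  | zero =>
    have := le_newton_step hm hr.le one_pos
    rw [hrm] at this
    simp only [inv_one, one_pow, mul_one] at this
    rw [newtonRoot]
    linarith
  | succ n ih =>
    have := le_newton_step hm hr.le (hr.trans_le ih)
    rwa [hrm] at this

lemma newtonRoot_pos {m : ℕ} (hm : 2 ≤ m) {x : ℝ} (hx : 0 < x) (n : ℕ) :
    0 < newtonRoot m n x :=
  (Real.rpow_pos_of_pos hx _).trans_le (rpow_inv_le_newtonRoot hm hx n)

lemma newtonRoot_succ_le_convex {m : ℕ} (hm : 2 ≤ m) {x : ℝ} (hx : 0 < x) (n : ℕ) :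
    newtonRoot m (n + 1) x ≤
      ((m : ℝ) - 1) / m * newtonRoot m n x + (m : ℝ)⁻¹ * x ^ ((m : ℝ)⁻¹) := by
  have h := newton_correction_le hm (Real.rpow_pos_of_pos hx _) (rpow_inv_le_newtonRoot hm hx n)
  rw [rpow_inv_natCast_pow_self hm hx] at h
  rw [newtonRoot]
  gcongr

lemma newtonRoot_succ_sub_le {m : ℕ} (hm : 2 ≤ m) {x : ℝ} (hx : 0 < x) (n : ℕ) :
    newtonRoot m (n + 1) x - x ^ ((m : ℝ)⁻¹) ≤
      ((m : ℝ) - 1) / m * (newtonRoot m n x - x ^ ((m : ℝ)⁻¹)) := by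
  have h := newtonRoot_succ_le_convex hm hx n
  have hm0 : (m : ℝ) ≠ 0 := by positivity
  have h1 : (m : ℝ)⁻¹ = 1 - ((m : ℝ) - 1) / m := by field_simp; ring
  have h2 : (m : ℝ)⁻¹ * x ^ ((m : ℝ)⁻¹) = (1 - ((m : ℝ) - 1) / m) * x ^ ((m : ℝ)⁻¹) :=
    congrArg (· * x ^ ((m : ℝ)⁻¹)) h1
  linarith

lemma newtonRoot_succ_le {m : ℕ} (hm : 2 ≤ m) {x : ℝ} (hx : 0 < x) (n : ℕ) :
    newtonRoot m (n + 1) x ≤ newtonRoot m n x := by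
  have h := newtonRoot_succ_sub_le hm hx n
  have h0 := rpow_inv_le_newtonRoot hm hx n
  have hc : ((m : ℝ) - 1) / m ≤ 1 := div_le_one_of_le₀ (by linarith) (by positivity)
  nlinarith

lemma newtonRoot_sub_le {m : ℕ} (hm : 2 ≤ m) {x : ℝ} (hx : 0 < x) (n : ℕ) :
    newtonRoot m n x - x ^ ((m : ℝ)⁻¹) ≤ (((m : ℝ) - 1) / m) ^ n * (x + 1) := by
  have hm' : (2 : ℝ) ≤ m := by exact_mod_cast hm
  have hc : 0 ≤ ((m : ℝ) - 1) / m := div_nonneg (by linarith) (by positivity)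
  induction n with
  | zero =>
    have h1 : (m : ℝ)⁻¹ ≤ 1 := inv_le_one_of_one_le₀ (by linarith)
    have h2 : ((m : ℝ) - 1) / m ≤ 1 := div_le_one_of_le₀ (by linarith) (by positivity)
    have h3 : 0 < x ^ ((m : ℝ)⁻¹) := Real.rpow_pos_of_pos hx _
    rw [newtonRoot]
    nlinarith
  | succ n ih =>
    refine (newtonRoot_succ_sub_le hm hx n).trans ?_
    rw [pow_succ', mul_assoc]
    gcongr

lemma continuousOn_newtonRoot {m : ℕ} (hm : 2 ≤ m) (n : ℕ) :
    ContinuousOn (newtonRoot m n) (Set.Ioi 0) := by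
  induction n with
  | zero =>
    change ContinuousOn (fun x => (m : ℝ)⁻¹ * x + ((m : ℝ) - 1) / m) _
    fun_prop
  | succ n ih =>
    have h : ContinuousOn (fun x => (newtonRoot m n x)⁻¹) (Set.Ioi 0) :=
      ih.inv₀ fun x hx => (newtonRoot_pos hm hx n).ne'
    change ContinuousOn (fun x => ((m : ℝ) - 1) / m * newtonRoot m n x +
      (m : ℝ)⁻¹ * (x * ((newtonRoot m n x)⁻¹) ^ (m - 1))) _
    fun_prop

lemma tendstoUniformlyOn_newtonRoot {m : ℕ} (hm : 2 ≤ m) {s : Set ℝ} (hs : s ⊆ Set.Ioi 0)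
    (hsb : BddAbove s) :
    TendstoUniformlyOn (newtonRoot m) (fun x => x ^ ((m : ℝ)⁻¹)) atTop s := by
  obtain ⟨M, hM⟩ := hsb
  have hm' : (2 : ℝ) ≤ m := by exact_mod_cast hm
  have hc : 0 ≤ ((m : ℝ) - 1) / m := div_nonneg (by linarith) (by positivity)
  have hc1 : ((m : ℝ) - 1) / m < 1 := (div_lt_one (by positivity)).2 (by linarith)
  have hlim : Tendsto (fun n : ℕ => (((m : ℝ) - 1) / m) ^ n * (M + 1)) atTop (𝓝 0) := by
    simpa using (tendsto_pow_atTop_nhds_zero_of_lt_one hc hc1).mul_const (M + 1)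
  rw [Metric.tendstoUniformlyOn_iff]
  intro ε hε
  filter_upwards [hlim.eventually_lt_const hε] with n hn x hx
  rw [dist_comm, Real.dist_eq,
    abs_of_nonneg (sub_nonneg.2 (rpow_inv_le_newtonRoot hm (hs hx) n))]
  refine (newtonRoot_sub_le hm (hs hx) n).trans_lt (lt_of_le_of_lt ?_ hn)
  gcongr
  exact hM hx

lemma conj_pow_of_mul_eq_one {R : Type*} [Monoid R] {s s' : R} (h : s * s' = 1) (h' : s' * s = 1)
    (t : R) (k : ℕ) : (s' * t * s) ^ k = s' * t ^ k * s := by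
  induction k with
  | zero => simp [h']
  | succ k ih =>
    calc (s' * t * s) ^ (k + 1) = s' * t ^ k * (s * s') * t * s := by
          rw [pow_succ, ih]; simp only [mul_assoc]
      _ = s' * t ^ (k + 1) * s := by rw [h, mul_one, pow_succ]; simp only [mul_assoc]

lemma ringInverse_eq_of_mul_eq_one {R : Type*} [MonoidWithZero R] {a b : R} (h : a * b = 1)
    (h' : b * a = 1) : Ring.inverse a = b :=
  Ring.inverse_unit ⟨a, b, h, h'⟩

section CFC

variable {R : Type*} [Ring R] [StarRing R] [TopologicalSpace R] [Algebra ℝ R]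
  [ContinuousFunctionalCalculus ℝ R IsSelfAdjoint]

lemma cfc_newtonRoot_zero (m : ℕ) {a : R} (ha : IsSelfAdjoint a) :
    cfc (newtonRoot m 0) a = (m : ℝ)⁻¹ • a + (((m : ℝ) - 1) / m) • (1 : R) := by
  have h : newtonRoot m 0 = fun x => (m : ℝ)⁻¹ * x + ((m : ℝ) - 1) / m := rfl
  rw [h, cfc_add a (fun x => (m : ℝ)⁻¹ * x) (fun _ => ((m : ℝ) - 1) / m),
    cfc_const_mul _ (fun x => x) a, cfc_id' ℝ a, cfc_const _ a, Algebra.algebraMap_eq_smul_one]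

lemma cfc_newtonRoot_succ {m : ℕ} (hm : 2 ≤ m) {a : R} (ha : IsSelfAdjoint a)
    (hpos : spectrum ℝ a ⊆ Set.Ioi 0) (n : ℕ) :
    cfc (newtonRoot m (n + 1)) a = (((m : ℝ) - 1) / m) • cfc (newtonRoot m n) a +
      (m : ℝ)⁻¹ • (a * cfc (fun x => (newtonRoot m n x)⁻¹) a ^ (m - 1)) := by
  have hf : ContinuousOn (newtonRoot m n) (spectrum ℝ a) :=
    (continuousOn_newtonRoot hm n).mono hpos
  have hg : ContinuousOn (fun x => (newtonRoot m n x)⁻¹) (spectrum ℝ a) :=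
    hf.inv₀ fun x hx => (newtonRoot_pos hm (hpos hx) n).ne'
  have h : newtonRoot m (n + 1) = fun x => ((m : ℝ) - 1) / m * newtonRoot m n x +
      (m : ℝ)⁻¹ * (x * ((newtonRoot m n x)⁻¹) ^ (m - 1)) := rfl
  rw [h, cfc_add a (fun x => ((m : ℝ) - 1) / m * newtonRoot m n x)
      (fun x => (m : ℝ)⁻¹ * (x * ((newtonRoot m n x)⁻¹) ^ (m - 1))),
    cfc_const_mul _ (newtonRoot m n) a,
    cfc_const_mul _ (fun x => x * ((newtonRoot m n x)⁻¹) ^ (m - 1)) a,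
    cfc_mul (fun x => x) (fun x => ((newtonRoot m n x)⁻¹) ^ (m - 1)) a,
    cfc_id' ℝ a, cfc_pow (fun x => (newtonRoot m n x)⁻¹) (m - 1) a]

lemma cfc_newtonRoot_mul_inv {m : ℕ} (hm : 2 ≤ m) {a : R} (ha : IsSelfAdjoint a)
    (hpos : spectrum ℝ a ⊆ Set.Ioi 0) (n : ℕ) :
    cfc (newtonRoot m n) a * cfc (fun x => (newtonRoot m n x)⁻¹) a = 1 := by
  have hf : ContinuousOn (newtonRoot m n) (spectrum ℝ a) :=
    (continuousOn_newtonRoot hm n).mono hpos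
  have hne : ∀ x ∈ spectrum ℝ a, newtonRoot m n x ≠ 0 :=
    fun x hx => (newtonRoot_pos hm (hpos hx) n).ne'
  rw [← cfc_mul (newtonRoot m n) (fun x => (newtonRoot m n x)⁻¹) a hf (hf.inv₀ hne), ← cfc_one ℝ a]
  exact cfc_congr fun x hx => mul_inv_cancel₀ (hne x hx)

end CFC

/-- **Convergence of the arithmetic-harmonic type algorithm.**
For positive invertible `A, B` and `m ≥ 2`, the sequence
`T_0 = (1/m)A + ((m−1)/m)B`, `T_{n+1} = ((m−1)/m) T_n + (1/m) A (T_n⁻¹ B)^{m−1}`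
converges decreasingly (in the Loewner order) to `Φ_{1/m}(A, B)`. -/
theorem power_mean_algorithm_converges {H : Type*} [NormedAddCommGroup H]
    [InnerProductSpace ℂ H] [CompleteSpace H] (m : ℕ) (hm : 2 ≤ m)
    (A B : H →L[ℂ] H) (hA : 0 ≤ A) (hB : 0 ≤ B) (hAu : IsUnit A) (hBu : IsUnit B)
    (T : ℕ → H →L[ℂ] H)
    (hT0 : T 0 = ((m : ℝ)⁻¹) • A + (((m : ℝ) - 1) / m) • B)
    (hTrec : ∀ n, T (n + 1) =
      (((m : ℝ) - 1) / m) • T n + ((m : ℝ)⁻¹) • (A * (Ring.inverse (T n) * B) ^ (m - 1))) :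
    (∀ n, T (n + 1) ≤ T n) ∧
      Filter.Tendsto T Filter.atTop (nhds (powerMean ((m : ℝ)⁻¹) A B)) := by
  set S : H →L[ℂ] H := B ^ ((1 : ℝ) / 2) with hS
  set S' : H →L[ℂ] H := B ^ (-(1 : ℝ) / 2) with hS'
  have hBpos : IsStrictlyPositive B := IsStrictlyPositive.iff_of_unital.2 ⟨hB, hBu⟩
  have hSS' : S * S' = 1 := by
    rw [hS, hS', neg_div]
    exact CFC.rpow_mul_rpow_neg _ hBpos
  have hS'S : S' * S = 1 := by
    rw [hS, hS', neg_div]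
    exact CFC.rpow_neg_mul_rpow _ hBpos
  have hSS : S * S = B := by
    rw [hS, ← CFC.rpow_add hBu, add_halves, CFC.rpow_one B hB]
  have hS0 : 0 ≤ S := CFC.rpow_nonneg
  have hS'0 : 0 ≤ S' := CFC.rpow_nonneg
  set a : H →L[ℂ] H := S' * A * S' with ha_def
  have ha0 : 0 ≤ a := conjugate_nonneg_of_nonneg hA hS'0
  have hS'u : IsUnit S' := ⟨⟨S', S, hS'S, hSS'⟩, rfl⟩
  have hau : IsUnit a := (hS'u.mul hAu).mul hS'u
  have hsa : IsSelfAdjoint a := ha0.isSelfAdjoint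
  have hpos : spectrum ℝ a ⊆ Set.Ioi 0 := fun x hx =>
    (IsStrictlyPositive.iff_of_unital.2 ⟨ha0, hau⟩).spectrum_pos hx
  have hA_eq : A = S * a * S := by
    calc A = (S * S') * A * (S' * S) := by rw [hSS', hS'S, one_mul, mul_one]
      _ = S * a * S := by simp only [ha_def, mul_assoc]
  have hT : ∀ n, T n = S * cfc (newtonRoot m n) a * S := by
    intro n
    induction n with
    | zero =>
      rw [hT0, cfc_newtonRoot_zero m hsa, mul_add, add_mul, mul_smul_comm, smul_mul_assoc,
        mul_smul_comm, smul_mul_assoc, mul_one, hSS, ← hA_eq]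
    | succ n ih =>
      set t := cfc (newtonRoot m n) a with ht
      set u := cfc (fun x => (newtonRoot m n x)⁻¹) a with hu
      have htu : t * u = 1 := cfc_newtonRoot_mul_inv hm hsa hpos n
      have hut : u * t = 1 := (cfc_commute_cfc _ _ a).eq.trans htu
      have hinv : Ring.inverse (T n) = S' * u * S' := by
        refine ringInverse_eq_of_mul_eq_one ?_ ?_
        · calc T n * (S' * u * S') = S * t * (S * S') * u * S' := by
                rw [ih]; simp only [mul_assoc]
            _ = S * (t * u) * S' := by rw [hSS', mul_one]; simp only [mul_assoc]
            _ = 1 := by rw [htu, mul_one, hSS']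
        · calc S' * u * S' * T n = S' * u * (S' * S) * t * S := by
                rw [ih]; simp only [mul_assoc]
            _ = S' * (u * t) * S := by rw [hS'S, mul_one]; simp only [mul_assoc]
            _ = 1 := by rw [hut, mul_one, hS'S]
      have hinvB : Ring.inverse (T n) * B = S' * u * S := by
        calc Ring.inverse (T n) * B = S' * u * (S' * S) * S := by
              rw [hinv, ← hSS]; simp only [mul_assoc]
          _ = S' * u * S := by rw [hS'S, mul_one]
      have hcorr : A * (Ring.inverse (T n) * B) ^ (m - 1) = S * (a * u ^ (m - 1)) * S := by
        rw [hinvB, conj_pow_of_mul_eq_one hSS' hS'S]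
        calc A * (S' * u ^ (m - 1) * S) = S * a * (S * S') * u ^ (m - 1) * S := by
              conv_lhs => rw [hA_eq]
              simp only [mul_assoc]
          _ = S * (a * u ^ (m - 1)) * S := by rw [hSS', mul_one]; simp only [mul_assoc]
      rw [hTrec, hcorr, ih, cfc_newtonRoot_succ hm hsa hpos, mul_add, add_mul, mul_smul_comm,
        smul_mul_assoc, mul_smul_comm, smul_mul_assoc]
  have hcont : ∀ n, ContinuousOn (newtonRoot m n) (spectrum ℝ a) := fun n =>
    (continuousOn_newtonRoot hm n).mono hpos
  refine ⟨fun n => ?_, ?_⟩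
  · rw [hT, hT]
    exact conjugate_le_conjugate_of_nonneg
      (cfc_mono (fun x hx => newtonRoot_succ_le hm (hpos hx) n) (hcont _) (hcont _)) hS0
  · have hlim : Tendsto (fun n => cfc (newtonRoot m n) a) atTop (𝓝 (a ^ ((m : ℝ)⁻¹))) := by
      rw [CFC.rpow_eq_cfc_real ha0]
      exact tendsto_cfc_fun
        (tendstoUniformlyOn_newtonRoot hm hpos (spectrum.isCompact a).bddAbove)
        (Eventually.of_forall hcont)
    rw [funext hT]
    exact (hlim.const_mul S).mul_const S
end

section
/- Let H be a complex Hilbert space, let m ≥ 2 be an integer, and let A, B be positive invertible bounded linear operators on H. With T_0 = (1/m)A + ((m−1)/m)B, T_{n+1} = ((m−1)/m) T_n + (1/m) A (T_n^{-1} B)^{m−1}, and T_0^{(−1)} := ((1/m)A^{-1} + ((m−1)/m)B^{-1})^{-1}, the estimate 0 ≤ T_n − Φ_{1/m}(A, B) ≤ (1 − 1/m)^n (T_0 − T_0^{(−1)}) holds for all n ≥ 0, where Φ_{1/m}(A, B) := B^{1/2} (B^{-1/2} A B^{-1/2})^{1/m} B^{1/2}. -/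
open scoped NNReal

/-- The Newton step at `y` for the equation `y ^ m = x`. -/
noncomputable def newtonStep (m : ℕ) (x y : ℝ) : ℝ :=
  ((m : ℝ) - 1) / m * y + (m : ℝ)⁻¹ * (x * y⁻¹ ^ (m - 1))

/-- The Newton iterates for the equation `y ^ m = x`, starting one step after `y = 1`. -/
noncomputable def newtonIterate (m : ℕ) : ℕ → ℝ → ℝ
  | 0 => fun x => newtonStep m x 1
  | n + 1 => fun x => newtonStep m x (newtonIterate m n x)

section Scalar

variable {m : ℕ} {x y : ℝ}

lemma rpow_inv_le_newtonStep (hm : m ≠ 0) (hx : 0 < x) (hy : 0 < y) :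
    x ^ (m : ℝ)⁻¹ ≤ newtonStep m x y := by
  obtain ⟨k, rfl⟩ := Nat.exists_eq_succ_of_ne_zero hm
  have hr : 0 < x ^ ((k.succ : ℕ) : ℝ)⁻¹ := Real.rpow_pos_of_pos hx _
  have hrm := Real.rpow_inv_natCast_pow hx.le hm
  set r := x ^ ((k.succ : ℕ) : ℝ)⁻¹
  have hbern : 1 + ((k.succ : ℕ) : ℝ) * (r / y - 1) ≤ (r / y) ^ k.succ :=
    one_add_mul_sub_le_pow (by linarith [div_pos hr hy]) _
  have hm0 : (0 : ℝ) < (k.succ : ℕ) := by positivity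
  have hstep : newtonStep k.succ x y =
      y / (k.succ : ℕ) * ((r / y) ^ k.succ + ((k.succ : ℕ) : ℝ) - 1) := by
    rw [newtonStep, ← hrm, Nat.succ_sub_one, div_pow, pow_succ y, inv_pow]
    field_simp
    ring
  calc r = y / (k.succ : ℕ) * (((k.succ : ℕ) : ℝ) * (r / y)) := by field_simp
    _ ≤ y / (k.succ : ℕ) * ((r / y) ^ k.succ + ((k.succ : ℕ) : ℝ) - 1) := by
      gcongr
      linarith
    _ = newtonStep k.succ x y := hstep.symm

lemma rpow_inv_le_newtonIterate (hm : m ≠ 0) (hx : 0 < x) (n : ℕ) :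
    x ^ (m : ℝ)⁻¹ ≤ newtonIterate m n x := by
  induction n with
  | zero => exact rpow_inv_le_newtonStep hm hx one_pos
  | succ n ih => exact rpow_inv_le_newtonStep hm hx ((Real.rpow_pos_of_pos hx _).trans_le ih)

lemma newtonIterate_pos (hm : m ≠ 0) (hx : 0 < x) (n : ℕ) : 0 < newtonIterate m n x :=
  (Real.rpow_pos_of_pos hx _).trans_le (rpow_inv_le_newtonIterate hm hx n)

lemma newtonStep_sub_le (hm : m ≠ 0) (hx : 0 < x) (hy : x ^ (m : ℝ)⁻¹ ≤ y) :
    newtonStep m x y - x ^ (m : ℝ)⁻¹ ≤ (1 - (m : ℝ)⁻¹) * (y - x ^ (m : ℝ)⁻¹) := by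
  have hr : 0 < x ^ (m : ℝ)⁻¹ := Real.rpow_pos_of_pos hx _
  have hrm := Real.rpow_inv_natCast_pow hx.le hm
  set r := x ^ (m : ℝ)⁻¹
  have hy0 : 0 < y := hr.trans_le hy
  have hm0 : (0 : ℝ) < m := by positivity
  have hle : x * y⁻¹ ^ (m - 1) ≤ r := by
    rw [← hrm, inv_pow, ← div_eq_mul_inv, div_le_iff₀ (by positivity)]
    calc r ^ m = r * r ^ (m - 1) := (mul_pow_sub_one hm r).symm
      _ ≤ r * y ^ (m - 1) := by gcongr
  have hcoef : ((m : ℝ) - 1) / m = 1 - (m : ℝ)⁻¹ := by field_simp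
  have := mul_le_mul_of_nonneg_left hle (inv_nonneg.2 hm0.le)
  rw [newtonStep, hcoef]
  linarith

lemma newtonIterate_sub_le (hm : m ≠ 0) (hx : 0 < x) (n : ℕ) :
    newtonIterate m n x - x ^ (m : ℝ)⁻¹ ≤
      (1 - (m : ℝ)⁻¹) ^ n * (newtonIterate m 0 x - x ^ (m : ℝ)⁻¹) := by
  induction n with
  | zero => simp
  | succ n ih =>
    have hm1 : (1 : ℝ) ≤ m := by exact_mod_cast Nat.one_le_iff_ne_zero.2 hm
    have hc : 0 ≤ 1 - (m : ℝ)⁻¹ := sub_nonneg.2 (inv_le_one_of_one_le₀ hm1)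
    calc newtonIterate m (n + 1) x - x ^ (m : ℝ)⁻¹
        ≤ (1 - (m : ℝ)⁻¹) * (newtonIterate m n x - x ^ (m : ℝ)⁻¹) :=
          newtonStep_sub_le hm hx (rpow_inv_le_newtonIterate hm hx n)
      _ ≤ (1 - (m : ℝ)⁻¹) *
          ((1 - (m : ℝ)⁻¹) ^ n * (newtonIterate m 0 x - x ^ (m : ℝ)⁻¹)) := by gcongr
      _ = _ := by ring

/-- The weighted harmonic mean of `x` and `1` is at most their weighted geometric mean. -/
lemma inv_newtonIterate_zero_inv_le (hm : m ≠ 0) (hx : 0 < x) :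
    (newtonIterate m 0 x⁻¹)⁻¹ ≤ x ^ (m : ℝ)⁻¹ := by
  have h := rpow_inv_le_newtonIterate hm (inv_pos.2 hx) 0
  rw [Real.inv_rpow hx.le] at h
  exact inv_le_of_inv_le₀ (Real.rpow_pos_of_pos hx _) h

lemma continuousOn_newtonIterate (hm : m ≠ 0) (n : ℕ) :
    ContinuousOn (newtonIterate m n) (Set.Ioi 0) := by
  induction n with
  | zero =>
    simp only [newtonIterate, newtonStep]
    fun_prop
  | succ n ih =>
    have hinv := ih.inv₀ fun x hx => (newtonIterate_pos hm hx n).ne'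
    exact (ih.const_mul _).add ((continuousOn_id.mul (hinv.pow _)).const_mul _)

end Scalar

section Ring

variable {R : Type*} [Ring R] {P Q : R}

lemma ringInverse_eq_of_mul_eq_one_s8 {a b : R} (hab : a * b = 1) (hba : b * a = 1) :
    Ring.inverse a = b :=
  Ring.inverse_unit ⟨a, b, hab, hba⟩

lemma ringInverse_conj (hPQ : P * Q = 1) (hQP : Q * P = 1) {C : R} (hC : IsUnit C) :
    Ring.inverse (P * C * P) = Q * Ring.inverse C * Q := by
  apply ringInverse_eq_of_mul_eq_one_s8
  · calc P * C * P * (Q * Ring.inverse C * Q)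
        = P * C * (P * Q) * Ring.inverse C * Q := by noncomm_ring
      _ = P * (C * Ring.inverse C) * Q := by rw [hPQ]; noncomm_ring
      _ = 1 := by rw [Ring.mul_inverse_cancel _ hC, mul_one, hPQ]
  · calc Q * Ring.inverse C * Q * (P * C * P)
        = Q * Ring.inverse C * (Q * P) * C * P := by noncomm_ring
      _ = Q * (Ring.inverse C * C) * P := by rw [hQP]; noncomm_ring
      _ = 1 := by rw [Ring.inverse_mul_cancel _ hC, mul_one, hQP]

lemma conj_pow_of_mul_eq_one_s8 (hPQ : P * Q = 1) (hQP : Q * P = 1) (D : R) (k : ℕ) :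
    (Q * D * P) ^ k = Q * D ^ k * P :=
  Units.conj_pow ⟨Q, P, hQP, hPQ⟩ D k

/-- The algorithm's recursion commutes with the congruence `C ↦ P * C * P`. -/
lemma mul_pow_inverse_conj (hPQ : P * Q = 1) (hQP : Q * P = 1) (X : R) {C : R}
    (hC : IsUnit C) (k : ℕ) :
    P * X * P * (Ring.inverse (P * C * P) * (P * P)) ^ k =
      P * (X * Ring.inverse C ^ k) * P := by
  have h : Q * Ring.inverse C * Q * (P * P) = Q * Ring.inverse C * P := by
    calc Q * Ring.inverse C * Q * (P * P) = Q * Ring.inverse C * (Q * P) * P := by noncomm_ring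
      _ = _ := by rw [hQP, mul_one]
  rw [ringInverse_conj hPQ hQP hC, h, conj_pow_of_mul_eq_one_s8 hPQ hQP]
  calc P * X * P * (Q * Ring.inverse C ^ k * P)
      = P * X * (P * Q) * Ring.inverse C ^ k * P := by noncomm_ring
    _ = _ := by rw [hPQ]; noncomm_ring

end Ring

section CStarAlgebra

variable {𝒜 : Type*} [CStarAlgebra 𝒜] [PartialOrder 𝒜] [StarOrderedRing 𝒜] {m : ℕ} {X : 𝒜}

lemma continuousOn_newtonIterate_spectrum (hm : m ≠ 0) (hX : IsStrictlyPositive X) (n : ℕ) :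
    ContinuousOn (newtonIterate m n) (spectrum ℝ X) :=
  (continuousOn_newtonIterate hm n).mono fun _ hx => hX.spectrum_pos hx

lemma isUnit_cfc_newtonIterate (hm : m ≠ 0) (hX : IsStrictlyPositive X) (n : ℕ) :
    IsUnit (cfc (newtonIterate m n) X) := by
  rw [isUnit_cfc_iff (newtonIterate m n) X (continuousOn_newtonIterate_spectrum hm hX n)]
  exact fun x hx => (newtonIterate_pos hm (hX.spectrum_pos hx) n).ne'

lemma cfc_newtonIterate_zero (hX : IsStrictlyPositive X) :
    cfc (newtonIterate m 0) X = (m : ℝ)⁻¹ • X + (((m : ℝ) - 1) / m) • (1 : 𝒜) := by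
  have hXs : IsSelfAdjoint X := hX.isSelfAdjoint
  have h : newtonIterate m 0 = fun x => (m : ℝ)⁻¹ * x + ((m : ℝ) - 1) / m := by
    ext x
    simp [newtonIterate, newtonStep, add_comm]
  rw [h, cfc_add _ (fun x : ℝ => (m : ℝ)⁻¹ * x) (fun _ => ((m : ℝ) - 1) / m),
    cfc_const_mul_id _ X, cfc_const _ X, Algebra.algebraMap_eq_smul_one]

lemma cfc_newtonIterate_succ (hm : m ≠ 0) (hX : IsStrictlyPositive X) (n : ℕ) :
    cfc (newtonIterate m (n + 1)) X =
      (((m : ℝ) - 1) / m) • cfc (newtonIterate m n) X +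
        (m : ℝ)⁻¹ • (X * Ring.inverse (cfc (newtonIterate m n) X) ^ (m - 1)) := by
  have hXs : IsSelfAdjoint X := hX.isSelfAdjoint
  have hc := continuousOn_newtonIterate_spectrum hm hX n
  have hne : ∀ x ∈ spectrum ℝ X, newtonIterate m n x ≠ 0 :=
    fun x hx => (newtonIterate_pos hm (hX.spectrum_pos hx) n).ne'
  have hci : ContinuousOn (fun x => (newtonIterate m n x)⁻¹) (spectrum ℝ X) := hc.inv₀ hne
  have hcp : ContinuousOn (fun x => (newtonIterate m n x)⁻¹ ^ (m - 1)) (spectrum ℝ X) :=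
    hci.pow _
  have hcm : ContinuousOn (fun x => x * (newtonIterate m n x)⁻¹ ^ (m - 1)) (spectrum ℝ X) :=
    continuousOn_id.mul hcp
  simp only [newtonIterate, newtonStep]
  rw [cfc_add X _ _ (hc.const_mul _) (hcm.const_mul _), cfc_const_mul _ _ X hc,
    cfc_const_mul _ _ X hcm, cfc_mul (fun x => x) _ X continuousOn_id hcp, cfc_id' ℝ X,
    cfc_pow _ _ X hci, cfc_inv _ X hne hc]

lemma continuousOn_newtonIterate_inv_spectrum (hm : m ≠ 0) (hX : IsStrictlyPositive X) (n : ℕ) :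
    ContinuousOn (fun x => newtonIterate m n x⁻¹) (spectrum ℝ X) :=
  (continuousOn_newtonIterate hm n).comp
    (continuousOn_id.inv₀ fun _ hx => (hX.spectrum_pos hx).ne')
    fun _ hx => inv_pos.2 (hX.spectrum_pos hx)

lemma newtonIterate_inv_ne_zero_of_mem_spectrum (hm : m ≠ 0) (hX : IsStrictlyPositive X) (n : ℕ) :
    ∀ x ∈ spectrum ℝ X, newtonIterate m n x⁻¹ ≠ 0 :=
  fun _ hx => (newtonIterate_pos hm (inv_pos.2 (hX.spectrum_pos hx)) n).ne'

lemma cfc_newtonIterate_zero_inv (hX : IsStrictlyPositive X) :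
    cfc (fun x => newtonIterate m 0 x⁻¹) X =
      (m : ℝ)⁻¹ • Ring.inverse X + (((m : ℝ) - 1) / m) • (1 : 𝒜) := by
  have hXs : IsSelfAdjoint X := hX.isSelfAdjoint
  have hci : ContinuousOn (fun x : ℝ => x⁻¹) (spectrum ℝ X) :=
    continuousOn_id.inv₀ fun x hx => (hX.spectrum_pos hx).ne'
  have h : (fun x => newtonIterate m 0 x⁻¹) =
      fun x : ℝ => (m : ℝ)⁻¹ * x⁻¹ + ((m : ℝ) - 1) / m := by
    ext x
    simp [newtonIterate, newtonStep, add_comm]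
  rw [h, cfc_add X _ _ (hci.const_mul _), cfc_const_mul _ _ X hci,
    cfc_inv (fun x => x) X (fun x hx => (hX.spectrum_pos hx).ne'), cfc_id' ℝ X, cfc_const _ X,
    Algebra.algebraMap_eq_smul_one]

end CStarAlgebra

/-- **Error estimate for the arithmetic-harmonic type algorithm.**
For positive invertible `A, B` and `m ≥ 2`, with `T_0 = (1/m)A + ((m−1)/m)B`,
`T_{n+1} = ((m−1)/m) T_n + (1/m) A (T_n⁻¹ B)^{m−1}` and
`T_0^{(−1)} = ((1/m)A⁻¹ + ((m−1)/m)B⁻¹)⁻¹`, one has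
`0 ≤ T_n − Φ_{1/m}(A, B) ≤ (1 − 1/m)^n (T_0 − T_0^{(−1)})` for all `n ≥ 0`. -/
theorem power_mean_algorithm_estimate {H : Type*} [NormedAddCommGroup H]
    [InnerProductSpace ℂ H] [CompleteSpace H] (m : ℕ) (hm : 2 ≤ m)
    (A B : H →L[ℂ] H) (hA : 0 ≤ A) (hB : 0 ≤ B) (hAu : IsUnit A) (hBu : IsUnit B)
    (T : ℕ → H →L[ℂ] H)
    (hT0 : T 0 = ((m : ℝ)⁻¹) • A + (((m : ℝ) - 1) / m) • B)
    (hTrec : ∀ n, T (n + 1) =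
      (((m : ℝ) - 1) / m) • T n + ((m : ℝ)⁻¹) • (A * (Ring.inverse (T n) * B) ^ (m - 1)))
    (T0inv : H →L[ℂ] H)
    (hT0inv : T0inv =
      Ring.inverse (((m : ℝ)⁻¹) • Ring.inverse A + (((m : ℝ) - 1) / m) • Ring.inverse B)) :
    ∀ n : ℕ, 0 ≤ T n - powerMean ((m : ℝ)⁻¹) A B ∧
      T n - powerMean ((m : ℝ)⁻¹) A B ≤ ((1 - (m : ℝ)⁻¹) ^ n) • (T 0 - T0inv) := by
  have hm0 : m ≠ 0 := by lia
  have hBp : IsStrictlyPositive B := hBu.isStrictlyPositive hB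
  set P := B ^ ((1 : ℝ) / 2) with hP
  set Q := B ^ (-(1 : ℝ) / 2) with hQ
  have hPn : 0 ≤ P := CFC.rpow_nonneg
  have hQn : 0 ≤ Q := CFC.rpow_nonneg
  have hPQ : P * Q = 1 := by
    rw [hP, hQ, neg_div]
    exact CFC.rpow_mul_rpow_neg _
  have hQP : Q * P = 1 := by
    rw [hP, hQ, neg_div]
    exact CFC.rpow_neg_mul_rpow _
  have hPP : P * P = B := by
    rw [hP, ← CFC.rpow_add hBu, add_halves, CFC.rpow_one B]
  set X := Q * A * Q with hX
  have hPXP : P * X * P = A := by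
    calc P * (Q * A * Q) * P = (P * Q) * A * (Q * P) := by noncomm_ring
      _ = A := by rw [hPQ, hQP, one_mul, mul_one]
  have hQu : IsUnit Q := ⟨⟨Q, P, hQP, hPQ⟩, rfl⟩
  have hXu : IsUnit X := (hQu.mul hAu).mul hQu
  have hXp : IsStrictlyPositive X :=
    hXu.isStrictlyPositive (conjugate_nonneg_of_nonneg hA hQn)
  have hXs : IsSelfAdjoint X := hXp.isSelfAdjoint
  have hpos : ∀ x ∈ spectrum ℝ X, 0 < x := fun x hx => hXp.spectrum_pos hx
  have hmean : powerMean ((m : ℝ)⁻¹) A B = P * cfc (fun x : ℝ => x ^ (m : ℝ)⁻¹) X * P := by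
    rw [← CFC.rpow_eq_cfc_real hXp.nonneg]
    rfl
  have hT : ∀ n, T n = P * cfc (newtonIterate m n) X * P := by
    intro n
    induction n with
    | zero =>
      rw [hT0, cfc_newtonIterate_zero hXp]
      simp only [mul_add, add_mul, mul_smul_comm, smul_mul_assoc, mul_one, hPXP, hPP]
    | succ n ih =>
      have hrec := mul_pow_inverse_conj hPQ hQP X (isUnit_cfc_newtonIterate hm0 hXp n) (m - 1)
      rw [hPXP, hPP] at hrec
      rw [hTrec, ih, hrec, cfc_newtonIterate_succ hm0 hXp]
      simp only [mul_add, add_mul, mul_smul_comm, smul_mul_assoc]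
  have hcinv := continuousOn_newtonIterate_inv_spectrum hm0 hXp 0
  have hne := newtonIterate_inv_ne_zero_of_mem_spectrum hm0 hXp 0
  have hTinv : T0inv = P * cfc (fun x => (newtonIterate m 0 x⁻¹)⁻¹) X * P := by
    have hD : IsUnit
        ((m : ℝ)⁻¹ • Ring.inverse X + (((m : ℝ) - 1) / m) • (1 : H →L[ℂ] H)) := by
      rw [← cfc_newtonIterate_zero_inv hXp, isUnit_cfc_iff _ X hcinv]
      exact hne
    have hAinv : Ring.inverse A = Q * Ring.inverse X * Q := by
      rw [← ringInverse_conj hPQ hQP hXu, hPXP]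
    have hBinv : Ring.inverse B = Q * Q := by
      rw [← hPP]
      simpa using ringInverse_conj hPQ hQP (isUnit_one (M := H →L[ℂ] H))
    rw [hT0inv, cfc_inv _ X hne hcinv, cfc_newtonIterate_zero_inv hXp, ← ringInverse_conj hQP hPQ hD, hAinv,
      hBinv]
    simp only [mul_add, add_mul, mul_smul_comm, smul_mul_assoc, mul_one]
  have hcr : ContinuousOn (fun x : ℝ => x ^ (m : ℝ)⁻¹) (spectrum ℝ X) :=
    continuousOn_id.rpow_const fun x hx => Or.inl (hpos x hx).ne'
  have hcn := continuousOn_newtonIterate_spectrum hm0 hXp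
  have hch : ContinuousOn (fun x => (newtonIterate m 0 x⁻¹)⁻¹) (spectrum ℝ X) :=
    hcinv.inv₀ hne
  have hc : 0 ≤ 1 - (m : ℝ)⁻¹ :=
    sub_nonneg.2 (inv_le_one_of_one_le₀ (by exact_mod_cast Nat.one_le_iff_ne_zero.2 hm0))
  intro n
  constructor
  · rw [sub_nonneg, hmean, hT]
    refine conjugate_le_conjugate_of_nonneg (cfc_mono (fun x hx => ?_) hcr (hcn n)) hPn
    exact rpow_inv_le_newtonIterate hm0 (hpos x hx) n
  · have hle : cfc (fun x => newtonIterate m n x - x ^ (m : ℝ)⁻¹) X ≤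
        cfc (fun x => (1 - (m : ℝ)⁻¹) ^ n *
          (newtonIterate m 0 x - (newtonIterate m 0 x⁻¹)⁻¹)) X := by
      refine cfc_mono (fun x hx => ?_) ((hcn n).sub hcr) (((hcn 0).sub hch).const_mul _)
      refine (newtonIterate_sub_le hm0 (hpos x hx) n).trans ?_
      gcongr
      exact inv_newtonIterate_zero_inv_le hm0 (hpos x hx)
    rw [cfc_sub _ _ X (hcn n) hcr, cfc_const_mul _ (fun x => newtonIterate m 0 x - (newtonIterate m 0 x⁻¹)⁻¹) X
        ((hcn 0).sub hch),
      cfc_sub _ _ X (hcn 0) hch] at hle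
    have h := conjugate_le_conjugate_of_nonneg hle hPn
    rw [hmean, hT, hT, hTinv]
    simpa only [mul_sub, sub_mul, mul_smul_comm, smul_mul_assoc] using h
end
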